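/- Let n ≥ 11 be odd, let S̃_n be Schur's double cover of S_n with projection π, let Ã_n = π^{-1}(A_n), and let g ∈ Ã_n be such that π(g) is an n-cycle. Then for every irreducible spin representation (ρ, V) of Ã_n, the minimal polynomial of ρ(g) equals X^n − ε_g; in particular ρ(g) has exactly n distinct eigenvalues. -/

import Mathlib

/-!
Schur's double cover `S̃_N` of the symmetric group, presented by generators
`z, t_1, …, t_{N-1}` and relations `z² = 1`, `t_i² = z`, `(t_i t_{i+1})³ = z`,
`(t_i t_j)² = z` for `|i − j| ≥ 2`.

Generators are indexed by `Option (Fin (N-1))`: `none` is the central element `z`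
and `some i` is `t_{i+1}` (so `some i` for `i = 0, …, N-2` are `t_1, …, t_{N-1}`).
-/

abbrev SchurGen (N : ℕ) := Option (Fin (N - 1))

namespace Schur

/-- The relator `z` as an element of the free group. -/
def zf (N : ℕ) : FreeGroup (SchurGen N) := FreeGroup.of none

/-- The generator `t_{i+1}` as an element of the free group. -/
def tf (N : ℕ) (i : Fin (N - 1)) : FreeGroup (SchurGen N) := FreeGroup.of (some i)

/-- The defining relators of Schur's double cover. -/
def rels (N : ℕ) : Set (FreeGroup (SchurGen N)) :=
  { r | r = zf N ^ 2 ∨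
        (∃ i, r = tf N i ^ 2 * (zf N)⁻¹) ∨
        (∃ i j : Fin (N - 1), (i : ℕ) + 1 = (j : ℕ) ∧
          r = (tf N i * tf N j) ^ 3 * (zf N)⁻¹) ∨
        (∃ i j : Fin (N - 1), ((i : ℕ) + 2 ≤ (j : ℕ) ∨ (j : ℕ) + 2 ≤ (i : ℕ)) ∧
          r = (tf N i * tf N j) ^ 2 * (zf N)⁻¹) }

/-- Schur's double cover `S̃_N` of the symmetric group `S_N`. -/
abbrev Cover (N : ℕ) := PresentedGroup (rels N)

/-- The central element `z` of `S̃_N`. -/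
def z (N : ℕ) : Cover N := PresentedGroup.of none

/-- The generator `t_{i+1}` of `S̃_N` (0-indexed). -/
def t (N : ℕ) (i : Fin (N - 1)) : Cover N := PresentedGroup.of (some i)

/-- The generator `t_i` of `S̃_N`, 1-indexed: meaningful for `1 ≤ i ≤ N-1`
(junk value `1` outside this range). -/
def T (N i : ℕ) : Cover N := if h : i - 1 < N - 1 then t N ⟨i - 1, h⟩ else 1

/-- The product `t_a t_{a+1} ⋯ t_{a+n-1}` (`n` consecutive generators, 1-indexed). -/
def P (N a n : ℕ) : Cover N := ((List.range n).map fun j => T N (a + j)).prod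

end Schur

/-- The adjacent transposition `(i, i+1)` of `{1, …, n}`: in 0-indexed terms, for
`i : Fin (n-1)` this is the swap of `i` and `i+1` in `Fin n`.  It is the image of the
generator `t_{i+1}` under the canonical projection `S̃_n → S_n`. -/
def Schur.adj (n : ℕ) (i : Fin (n - 1)) : Equiv.Perm (Fin n) :=
  Equiv.swap ⟨i.1, by have := i.2; omega⟩ ⟨i.1 + 1, by have := i.2; omega⟩

section Coxeter

variable {Q : Type*} [Group Q]

/-- The product `s (j + l - 1) * ⋯ * s (j + 1) * s j`. -/
def descProd (s : ℕ → Q) (j : ℕ) : ℕ → Q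
  | 0 => 1
  | l + 1 => s (j + l) * descProd s j l

/-- The relations of the Coxeter group of type `A_m` for `s 0, …, s (m - 1)`. -/
structure CoxeterRel (s : ℕ → Q) (m : ℕ) : Prop where
  sq : ∀ i < m, s i * s i = 1
  braid : ∀ i, i + 1 < m → s i * s (i + 1) * s i = s (i + 1) * s i * s (i + 1)
  comm : ∀ i j, i + 2 ≤ j → j < m → s i * s j = s j * s i

variable {s : ℕ → Q} {m : ℕ}

lemma CoxeterRel.descProd_mul_of_lt (h : CoxeterRel s m) {i j : ℕ} (l : ℕ) (hij : i + 2 ≤ j)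
    (hl : j + l ≤ m) : descProd s j l * s i = s i * descProd s j l := by
  induction l with
  | zero => simp [descProd]
  | succ l ih =>
    rw [descProd, mul_assoc, ih (by omega), ← mul_assoc, ← h.comm i (j + l) (by omega) (by omega),
      mul_assoc]

lemma CoxeterRel.descProd_mul_of_gt (h : CoxeterRel s m) {i j : ℕ} (l : ℕ) (hij : j + l + 1 ≤ i)
    (hl : i < m) : descProd s j l * s i = s i * descProd s j l := by
  induction l with
  | zero => simp [descProd]
  | succ l ih =>
    rw [descProd, mul_assoc, ih (by omega), ← mul_assoc, h.comm (j + l) i (by omega) (by omega),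
      mul_assoc]

lemma CoxeterRel.descProd_mul_of_mem (h : CoxeterRel s m) {i j : ℕ} (l : ℕ) (hji : j ≤ i)
    (hil : i + 1 < j + l) (hl : j + l ≤ m) :
    descProd s j l * s (i + 1) = s i * descProd s j l := by
  induction l with
  | zero => omega
  | succ l ih =>
    rcases Nat.lt_or_ge (i + 1) (j + l) with h1 | h1
    · rw [descProd, mul_assoc, ih h1 (by omega), ← mul_assoc, ← h.comm i (j + l) (by omega)
        (by omega), mul_assoc]
    · obtain ⟨l, rfl⟩ : ∃ l', l = l' + 1 := ⟨l - 1, by omega⟩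
      obtain rfl : i = j + l := by omega
      rw [descProd, descProd, mul_assoc, mul_assoc, h.descProd_mul_of_gt l (by omega) (by omega)]
      have := h.braid (j + l) (by omega)
      simp only [← mul_assoc, ← add_assoc] at this ⊢
      rw [this]

lemma CoxeterRel.exists_eq_mul_descProd (h : CoxeterRel s m) {k : ℕ} (hk : k < m) {x : Q}
    (hx : x ∈ Subgroup.closure (s '' {i | i < k + 1})) :
    ∃ y ∈ Subgroup.closure (s '' {i | i < k}), ∃ j l, j + l = k + 1 ∧ x = y * descProd s j l := by
  have hstep : ∀ x, (∃ y ∈ Subgroup.closure (s '' {i | i < k}),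
      ∃ j l, j + l = k + 1 ∧ x = y * descProd s j l) → ∀ i < k + 1,
      ∃ y ∈ Subgroup.closure (s '' {i | i < k}), ∃ j l, j + l = k + 1 ∧
        x * s i = y * descProd s j l := by
    rintro _ ⟨y, hy, j, l, hjl, rfl⟩ i hi
    have hmem : ∀ i < k, y * s i ∈ Subgroup.closure (s '' {i | i < k}) := fun i hi =>
      mul_mem hy (Subgroup.subset_closure ⟨i, hi, rfl⟩)
    rcases Nat.lt_or_ge (i + 1) j with h1 | h1
    · exact ⟨y * s i, hmem i (by omega), j, l, hjl, by
        rw [mul_assoc, h.descProd_mul_of_lt l (by omega) (by omega), mul_assoc]⟩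
    rcases eq_or_lt_of_le h1 with rfl | h1
    · refine ⟨y, hy, i, l + 1, by omega, ?_⟩
      rw [mul_assoc]
      congr 1
      clear hjl hi
      have : ∀ l, descProd s (i + 1) l * s i = descProd s i (l + 1) := by
        intro l
        induction l with
        | zero => simp [descProd]
        | succ l ih =>
          rw [descProd, mul_assoc, ih, descProd, descProd, descProd]
          simp only [add_assoc, add_comm 1]
      exact this l
    rcases eq_or_lt_of_le (Nat.lt_succ_iff.mp h1) with rfl | h1
    · obtain ⟨l, rfl⟩ : ∃ l', l = l' + 1 := ⟨l - 1, by omega⟩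
      refine ⟨y, hy, j + 1, l, by omega, ?_⟩
      rw [mul_assoc]
      congr 1
      have : ∀ l, descProd s j (l + 1) = descProd s (j + 1) l * s j := by
        intro l
        induction l with
        | zero => simp [descProd]
        | succ l ih =>
          rw [descProd, ih, descProd, mul_assoc]
          simp only [add_assoc, add_comm 1]
      rw [this, mul_assoc, h.sq j (by omega), mul_one]
    · obtain ⟨i, rfl⟩ : ∃ i', i = i' + 1 := ⟨i - 1, by omega⟩
      exact ⟨y * s i, hmem i (by omega), j, l, hjl, by
        rw [mul_assoc, h.descProd_mul_of_mem l (by omega) (by omega) (by omega), mul_assoc]⟩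
  induction hx using Subgroup.closure_induction_right with
  | one => exact ⟨1, one_mem _, k + 1, 0, rfl, by simp [descProd]⟩
  | mul_right x y hx hy ih =>
    obtain ⟨i, hi, rfl⟩ := hy
    exact hstep x ih i hi
  | mul_inv_cancel x y hx hy ih =>
    obtain ⟨i, hi, rfl⟩ := hy
    rw [inv_eq_of_mul_eq_one_right (h.sq i (lt_of_lt_of_le hi hk))]
    exact hstep x ih i hi

/-- The symmetric group is presented by the Coxeter relations. -/
lemma CoxeterRel.eq_one_of_map_eq_one (h : CoxeterRel s m) (φ : Q →* Equiv.Perm ℕ)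
    (hφ : ∀ i < m, φ (s i) = Equiv.swap i (i + 1)) (k : ℕ) (hk : k ≤ m) (x : Q)
    (hx : x ∈ Subgroup.closure (s '' {i | i < k})) (hx1 : φ x = 1) : x = 1 := by
  induction k generalizing x with
  | zero => simpa using hx
  | succ k ih =>
    obtain ⟨y, hy, j, l, hjl, rfl⟩ := h.exists_eq_mul_descProd (by omega) hx
    have hfix : φ y (k + 1) = k + 1 := by
      have : Subgroup.closure (s '' {i | i < k}) ≤
          (MulAction.stabilizer (Equiv.Perm ℕ) (k + 1)).comap φ := by
        rw [Subgroup.closure_le]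
        rintro _ ⟨i, hi, rfl⟩
        have hi : i < k := hi
        simp only [Subgroup.coe_comap, Set.mem_preimage, SetLike.mem_coe,
          MulAction.mem_stabilizer_iff, hφ i (by omega)]
        exact Equiv.swap_apply_of_ne_of_ne (by omega) (by omega)
      exact this hy
    have hdesc : ∀ l, j + l ≤ m → φ (descProd s j l) j = j + l := by
      intro l
      induction l with
      | zero => simp [descProd]
      | succ l ih =>
        intro hl
        rw [descProd, map_mul, Equiv.Perm.mul_apply, ih (by omega), hφ _ (by omega),
          Equiv.swap_apply_left, add_assoc]
    have h1 : φ (y * descProd s j l) j = k + 1 := by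
      rw [map_mul, Equiv.Perm.mul_apply, hdesc l (by omega), hjl, hfix]
    rw [hx1, Equiv.Perm.one_apply] at h1
    obtain rfl : l = 0 := by omega
    simp only [descProd, mul_one] at hx1 ⊢
    exact ih (by omega) y hy hx1

end Coxeter

/-- `π : G → Perm α` is a central extension with kernel `{1, z}` in which lifts of disjoint
transpositions commute up to the factor `z`. -/
structure SpinCover {G α : Type*} [Group G] [DecidableEq α] (π : G →* Equiv.Perm α) (z : G) :
    Prop where
  surj : Function.Surjective π
  central : ∀ x, z * x = x * z
  sq : z * z = 1
  map_z : π z = 1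
  ker : ∀ x, π x = 1 → x = 1 ∨ x = z
  anti : ∀ a b c d : α, [a, b, c, d].Nodup → ∀ x y, π x = Equiv.swap a b → π y = Equiv.swap c d →
    x * y = z * (y * x)

namespace Schur

variable {n : ℕ}

lemma z_sq (n : ℕ) : z n * z n = 1 := by
  have : PresentedGroup.mk (rels n) (zf n ^ 2) = 1 :=
    PresentedGroup.one_of_mem (Or.inl rfl)
  rwa [map_pow, pow_two] at this

lemma t_sq (i : Fin (n - 1)) : t n i * t n i = z n := by
  have : PresentedGroup.mk (rels n) (tf n i ^ 2 * (zf n)⁻¹) = 1 :=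
    PresentedGroup.one_of_mem (Or.inr (Or.inl ⟨i, rfl⟩))
  rw [map_mul, map_inv, mul_inv_eq_one, map_pow, pow_two] at this
  exact this

lemma t_braid (i j : Fin (n - 1)) (h : (i : ℕ) + 1 = j) : (t n i * t n j) ^ 3 = z n := by
  have : PresentedGroup.mk (rels n) ((tf n i * tf n j) ^ 3 * (zf n)⁻¹) = 1 :=
    PresentedGroup.one_of_mem (Or.inr (Or.inr (Or.inl ⟨i, j, h, rfl⟩)))
  rw [map_mul, map_inv, mul_inv_eq_one, map_pow, map_mul] at this
  exact this

lemma t_comm (i j : Fin (n - 1)) (h : (i : ℕ) + 2 ≤ j) : (t n i * t n j) ^ 2 = z n := by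
  have : PresentedGroup.mk (rels n) ((tf n i * tf n j) ^ 2 * (zf n)⁻¹) = 1 :=
    PresentedGroup.one_of_mem (Or.inr (Or.inr (Or.inr ⟨i, j, Or.inl h, rfl⟩)))
  rw [map_mul, map_inv, mul_inv_eq_one, map_pow, map_mul] at this
  exact this

lemma z_central (x : Cover n) : z n * x = x * z n := by
  have : x ∈ Subgroup.closure (Set.range (PresentedGroup.of (rels := rels n))) := by
    rw [PresentedGroup.closure_range_of]; trivial
  induction this using Subgroup.closure_induction with
  | mem x hx =>
    obtain ⟨_ | i, rfl⟩ := hx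
    · rfl
    · change z n * t n i = t n i * z n
      rw [← t_sq i, mul_assoc]
  | one => simp
  | mul x y _ _ hx hy => rw [← mul_assoc, hx, mul_assoc, hy, mul_assoc]
  | inv x _ hx => rw [← mul_left_inj x, ← mul_right_inj x]; simp [mul_assoc, hx]

lemma ker_pi (hn : 2 ≤ n) (π : Cover n →* Equiv.Perm (Fin n)) (hπt : ∀ i, π (t n i) = adj n i)
    (hπz : π (z n) = 1) (x : Cover n) (hx : π x = 1) : x = 1 ∨ x = z n := by
  have hN : (Subgroup.zpowers (z n)).Normal := by
    refine ⟨fun a ha g => ?_⟩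
    have : Commute g a := by
      obtain ⟨k, rfl⟩ := Subgroup.mem_zpowers_iff.mp ha
      exact (show Commute g (z n) from (z_central g).symm).zpow_right k
    rwa [this.eq, mul_inv_cancel_right]
  let q := QuotientGroup.mk' (Subgroup.zpowers (z n))
  have hqz : q (z n) = 1 := (QuotientGroup.eq_one_iff _).mpr (Subgroup.mem_zpowers _)
  let s : ℕ → Cover n ⧸ Subgroup.zpowers (z n) := fun i =>
    if h : i < n - 1 then q (t n ⟨i, h⟩) else 1
  have hs : ∀ i (h : i < n - 1), s i = q (t n ⟨i, h⟩) := fun i h => dif_pos h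
  have hsq : ∀ i < n - 1, s i * s i = 1 := fun i hi => by
    rw [hs i hi, ← map_mul, t_sq, hqz]
  have hsi : ∀ i < n - 1, (s i)⁻¹ = s i := fun i hi =>
    inv_eq_of_mul_eq_one_right (hsq i hi)
  have hrel : CoxeterRel s (n - 1) := by
    refine ⟨hsq, fun i hi => ?_, fun i j hij hj => ?_⟩
    · have h1 : (s i * s (i + 1)) ^ 3 = 1 := by
        rw [hs i (by omega), hs (i + 1) hi, ← map_mul, ← map_pow, t_braid _ _ rfl, hqz]
      have h2 : s i * s (i + 1) * s i * (s (i + 1) * s i * s (i + 1)) = 1 := by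
        rw [← h1]; simp only [pow_succ, pow_zero, one_mul, mul_assoc]
      rw [eq_inv_of_mul_eq_one_left h2]
      simp only [mul_inv_rev, hsi i (by omega), hsi (i + 1) hi, mul_assoc]
    · have h1 : (s i * s j) ^ 2 = 1 := by
        rw [hs i (by omega), hs j hj, ← map_mul, ← map_pow, t_comm _ _ hij, hqz]
      rw [pow_two] at h1
      rw [eq_inv_of_mul_eq_one_left h1, mul_inv_rev, hsi i (by omega), hsi j hj]
  let φ : Cover n ⧸ Subgroup.zpowers (z n) →* Equiv.Perm ℕ :=
    (Equiv.Perm.viaEmbeddingHom Fin.valEmbedding).comp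
      (QuotientGroup.lift (Subgroup.zpowers (z n)) π
        (by rw [Subgroup.zpowers_le]; exact hπz))
  have hφq : ∀ x, φ (q x) = Equiv.Perm.viaEmbeddingHom Fin.valEmbedding (π x) := fun x => rfl
  have hφ : ∀ i < n - 1, φ (s i) = Equiv.swap i (i + 1) := by
    intro i hi
    rw [hs i hi, hφq, hπt, Equiv.Perm.viaEmbeddingHom_apply]
    ext k
    by_cases hk : k < n
    · have := Equiv.Perm.viaEmbedding_apply (adj n ⟨i, hi⟩) Fin.valEmbedding ⟨k, hk⟩
      simp only [Fin.valEmbedding_apply] at this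
      rw [this, adj]
      simp only [Equiv.swap_apply_def, Fin.ext_iff]
      split_ifs <;> rfl
    · rw [Equiv.Perm.viaEmbedding_apply_of_notMem]
      · rw [Equiv.swap_apply_of_ne_of_ne] <;> omega
      · rintro ⟨y, rfl⟩
        exact hk y.2
  have hgen : ∀ x : Cover n, q x ∈ Subgroup.closure (s '' {i | i < n - 1}) := by
    intro x
    have : x ∈ Subgroup.closure (Set.range (PresentedGroup.of (rels := rels n))) := by
      rw [PresentedGroup.closure_range_of]; trivial
    have hle : Subgroup.closure (Set.range (PresentedGroup.of (rels := rels n))) ≤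
        (Subgroup.closure (s '' {i | i < n - 1})).comap q := by
      rw [Subgroup.closure_le]
      rintro _ ⟨_ | i, rfl⟩
      · exact (show q (z n) ∈ Subgroup.closure (s '' {i | i < n - 1}) from hqz ▸ one_mem _)
      · exact Subgroup.subset_closure ⟨i, i.2, hs i i.2⟩
    exact hle this
  have h1 : q x = 1 := hrel.eq_one_of_map_eq_one φ hφ (n - 1) le_rfl (q x) (hgen x) (by
    rw [hφq, hx, map_one])
  obtain ⟨k, hk⟩ := Subgroup.mem_zpowers_iff.mp ((QuotientGroup.eq_one_iff x).mp h1)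
  have hzz : z n ^ (2 : ℤ) = 1 := by rw [zpow_two, z_sq]
  rcases Int.even_or_odd' k with ⟨c, rfl | rfl⟩
  · left; rw [← hk, zpow_mul, hzz, one_zpow]
  · right; rw [← hk, zpow_add, zpow_mul, hzz, one_zpow, one_mul, zpow_one]

lemma pi_surjective (hn : 2 ≤ n) (π : Cover n →* Equiv.Perm (Fin n))
    (hπt : ∀ i, π (t n i) = adj n i) : Function.Surjective π := by
  rw [← MonoidHom.range_eq_top]
  obtain ⟨m, rfl⟩ : ∃ m, n = m + 1 := ⟨n - 1, by omega⟩
  have hmem : ∀ x ∈ Set.range (fun i : Fin m => Equiv.swap i.castSucc i.succ), x ∈ π.range := by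
    rintro _ ⟨i, rfl⟩
    exact ⟨t (m + 1) i, hπt i⟩
  rw [eq_top_iff]
  intro x _
  have := Equiv.Perm.mclosure_swap_castSucc_succ m
  have hx : x ∈ Submonoid.closure (Set.range fun i : Fin m => Equiv.swap i.castSucc i.succ) := by
    rw [this]; trivial
  exact (Submonoid.closure_le (S := π.range.toSubmonoid)).mpr hmem hx

lemma exists_perm_of_nodup {α : Type*} [DecidableEq α] [Fintype α] {k : ℕ} (f g : Fin k ↪ α) :
    ∃ σ : Equiv.Perm α, ∀ i, σ (f i) = g i := by
  classical
  let e : Set.range f ≃ Set.range g :=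
    (Equiv.ofInjective f f.injective).symm.trans (Equiv.ofInjective g g.injective)
  refine ⟨e.extendSubtype, fun i => ?_⟩
  rw [Equiv.extendSubtype_apply_of_mem e (f i) ⟨i, rfl⟩]
  have : (Equiv.ofInjective f f.injective).symm ⟨f i, ⟨i, rfl⟩⟩ = i :=
    (Equiv.symm_apply_eq _).mpr rfl
  change ((Equiv.ofInjective g g.injective) _ : α) = _
  erw [this]
  rfl

theorem spinCover (hn : 4 ≤ n) (π : Cover n →* Equiv.Perm (Fin n))
    (hπt : ∀ i, π (t n i) = adj n i) (hπz : π (z n) = 1) : SpinCover π (z n) where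
  surj := pi_surjective (by omega) π hπt
  central := z_central
  sq := z_sq n
  map_z := hπz
  ker := ker_pi (by omega) π hπt hπz
  anti := by
    intro a b c d hnd x y hx hy
    have hzc := z_central (n := n)
    have h0 : (0 : ℕ) < n - 1 := by omega
    have h2 : (2 : ℕ) < n - 1 := by omega
    let e : Fin 4 ↪ Fin n := ⟨fun i => ⟨i, by omega⟩, fun i j h => by
      simpa [Fin.ext_iff] using h⟩
    let f : Fin 4 ↪ Fin n := ⟨[a, b, c, d].get, List.nodup_iff_injective_get.mp hnd⟩
    obtain ⟨σ, hσ⟩ := exists_perm_of_nodup e f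
    obtain ⟨w, rfl⟩ := pi_surjective (by omega) π hπt σ
    have hfix : ∀ u v, π u = π v → u = v ∨ u = z n * v := by
      intro u v h
      have := ker_pi (by omega) π hπt hπz (u * v⁻¹) (by rw [map_mul, map_inv, h, mul_inv_cancel])
      rcases this with h | h
      · left; exact mul_inv_eq_one.mp h
      · right; rw [← h, inv_mul_cancel_right]
    have hzz := z_sq n
    have htt : t n ⟨0, h0⟩ * t n ⟨2, h2⟩ = z n * (t n ⟨2, h2⟩ * t n ⟨0, h0⟩) := by
      have h := t_comm ⟨0, h0⟩ ⟨2, h2⟩ (le_refl 2)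
      have h3 := t_sq (⟨0, h0⟩ : Fin (n - 1))
      have h4 := t_sq (⟨2, h2⟩ : Fin (n - 1))
      generalize t n ⟨0, h0⟩ = s at *
      generalize t n ⟨2, h2⟩ = r at *
      have h5 : s * r * (s * r) * (r * s) = z n * (r * s) := by rw [← pow_two, h]
      rw [← h5]
      have : s * r * (s * r) * (r * s) = s * r * (s * (r * r) * s) := by simp only [mul_assoc]
      rw [this, h4, mul_assoc s (z n) s, hzc s, ← mul_assoc s s, h3, hzz, mul_one]
    have hx' : π x = π (w * t n ⟨0, h0⟩ * w⁻¹) := by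
      rw [hx, map_mul, map_mul, map_inv, hπt]
      have : adj n ⟨0, h0⟩ = Equiv.swap (e 0) (e 1) := rfl
      rw [this, ← Equiv.swap_apply_apply, hσ, hσ]; rfl
    have hy' : π y = π (w * t n ⟨2, h2⟩ * w⁻¹) := by
      rw [hy, map_mul, map_mul, map_inv, hπt]
      have : adj n ⟨2, h2⟩ = Equiv.swap (e 2) (e 3) := rfl
      rw [this, ← Equiv.swap_apply_apply, hσ, hσ]; rfl
    have hc : (w * t n ⟨0, h0⟩ * w⁻¹) * (w * t n ⟨2, h2⟩ * w⁻¹) =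
        z n * ((w * t n ⟨2, h2⟩ * w⁻¹) * (w * t n ⟨0, h0⟩ * w⁻¹)) := by
      have h1 : (w * t n ⟨0, h0⟩ * w⁻¹) * (w * t n ⟨2, h2⟩ * w⁻¹) =
        w * (t n ⟨0, h0⟩ * t n ⟨2, h2⟩) * w⁻¹ := by group
      rw [h1, htt, ← mul_assoc w, ← hzc w]
      group
    have hz1 : ∀ u v, z n * u * v = z n * (u * v) := fun u v => mul_assoc _ _ _
    have hz2 : ∀ u v, u * (z n * v) = z n * (u * v) := fun u v => by
      rw [← mul_assoc, ← hzc u, mul_assoc]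
    rcases hfix _ _ hx' with h | h <;> rcases hfix _ _ hy' with h' | h' <;> rw [h, h'] <;>
      simp only [hz1, hz2, hc]

end Schur

namespace SpinCover

open Equiv

variable {G α : Type*} [Group G] [DecidableEq α] {π : G →* Perm α} {z : G}

lemma mul_z (h : SpinCover π z) (x y : G) : x * (z * y) = z * (x * y) := by
  rw [← mul_assoc, ← h.central x, mul_assoc]

lemma z_mul_z (h : SpinCover π z) (x : G) : z * (z * x) = x := by
  rw [← mul_assoc, h.sq, one_mul]

lemma eq_or_of_map_eq (h : SpinCover π z) {x y : G} (hxy : π x = π y) : x = y ∨ x = z * y := by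
  rcases h.ker (x * y⁻¹) (by rw [map_mul, map_inv, hxy, mul_inv_cancel]) with h1 | h1
  · exact Or.inl (mul_inv_eq_one.mp h1)
  · exact Or.inr (by rw [← h1, inv_mul_cancel_right])

lemma commute_of_map_eq_one (h : SpinCover π z) {x : G} (hx : π x = 1) (y : G) : Commute x y := by
  rcases h.ker x hx with rfl | rfl
  · exact Commute.one_left y
  · exact h.central y

variable [Fintype α]

/-- A lift of a transposition is centralised, up to sign, by the elements fixing both points. -/
lemma mul_lift_swap (h : SpinCover π z) {a b : α} (hab : a ≠ b) {s y : G} (hs : π s = swap a b)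
    (hya : π y a = a) (hyb : π y b = b) :
    (Perm.sign (π y) = 1 → y * s = s * y) ∧ (Perm.sign (π y) = -1 → y * s = z * (s * y)) := by
  have key : ∀ f : Perm {x // x ≠ a ∧ x ≠ b}, ∀ y, π y = Perm.ofSubtype f →
      (Perm.sign (π y) = 1 → y * s = s * y) ∧ (Perm.sign (π y) = -1 → y * s = z * (s * y)) := by
    intro f
    induction f using Perm.swap_induction_on with
    | one =>
      intro y hy
      rw [map_one] at hy
      refine ⟨fun _ => h.commute_of_map_eq_one hy s, fun h1 => ?_⟩
      rw [hy, map_one] at h1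
      exact absurd h1 (by decide)
    | swap_mul f c d hcd ih =>
      intro y hy
      obtain ⟨u, hu⟩ := h.surj (swap (c : α) d)
      have hcd' : (c : α) ≠ d := fun e => hcd (Subtype.ext e)
      have hus : u * s = z * (s * u) := h.anti c d a b (by
        have hc := c.2; have hd := d.2
        simp [hcd', hc.1, hc.2, hd.1, hd.2, hab]) u s hu hs
      have hyf : π (u⁻¹ * y) = Perm.ofSubtype f := by
        rw [map_mul, map_inv, hu, hy, map_mul, Perm.ofSubtype_swap_eq, inv_mul_cancel_left]
      have hsg : Perm.sign (π y) = - Perm.sign (π (u⁻¹ * y)) := by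
        rw [map_mul, map_mul, map_inv, map_inv, hu, Perm.sign_swap hcd']
        simp
      obtain ⟨i1, i2⟩ := ih _ hyf
      have hyu : y = u * (u⁻¹ * y) := by group
      generalize u⁻¹ * y = v at *
      subst hyu
      constructor
      · intro h1
        have := i2 (by rw [h1] at hsg; rw [hsg, neg_neg])
        rw [mul_assoc, this, h.mul_z, ← mul_assoc, ← mul_assoc, mul_assoc z, hus, h.z_mul_z,
          mul_assoc]
      · intro h1
        have := i1 (by rw [h1] at hsg; exact (neg_injective hsg).symm)
        rw [mul_assoc, this, ← mul_assoc, hus]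
        simp only [mul_assoc]
  have hiff : ∀ x, (x ≠ a ∧ x ≠ b) ↔ (π y x ≠ a ∧ π y x ≠ b) := fun x => by
    have h1 : π y x = a ↔ x = a := by
      conv_lhs => rw [← hya]
      exact (π y).injective.eq_iff
    have h2 : π y x = b ↔ x = b := by
      conv_lhs => rw [← hyb]
      exact (π y).injective.eq_iff
    simp only [ne_eq, h1, h2]
  refine key ((π y).subtypePerm fun x => (hiff x).symm) y ?_
  rw [Perm.ofSubtype_subtypePerm]
  intro x hx
  constructor <;> rintro rfl
  · exact hx hya
  · exact hx hyb

/-- An even element commutes with everything supported on its fixed points. -/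
lemma commute_of_even (h : SpinCover π z) {x y : G} (hy : Perm.sign (π y) = 1)
    (hxy : ∀ a, π x a ≠ a → π y a = a) : Commute x y := by
  have key : ∀ f : Perm {a // π y a = a}, ∀ x, π x = Perm.ofSubtype f → Commute x y := by
    intro f
    induction f using Perm.swap_induction_on with
    | one =>
      intro x hx
      exact h.commute_of_map_eq_one (by rw [hx, map_one]) y
    | swap_mul f c d hcd ih =>
      intro x hx
      obtain ⟨u, hu⟩ := h.surj (swap (c : α) d)
      have hcd' : (c : α) ≠ d := fun e => hcd (Subtype.ext e)
      have hxf : π (u⁻¹ * x) = Perm.ofSubtype f := by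
        rw [map_mul, map_inv, hu, hx, map_mul, Perm.ofSubtype_swap_eq, inv_mul_cancel_left]
      have h1 : Commute u y := ((h.mul_lift_swap hcd' hu c.2 d.2).1 hy).symm
      have := h1.mul_left (ih _ hxf)
      rwa [mul_inv_cancel_left] at this
  have hiff : ∀ a, π y (π x a) = π x a ↔ π y a = a := by
    intro a
    by_cases ha : π x a = a
    · rw [ha]
    · exact ⟨fun _ => hxy a ha, fun _ => hxy _ fun e => ha ((π x).injective e)⟩
  refine key ((π x).subtypePerm hiff) x ?_
  rw [Perm.ofSubtype_subtypePerm hiff hxy]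

/-- An even element exchanging `a, b` and `c, d` anticommutes with lifts of `(a c)(b d)`. -/
lemma anticommute_of_double_swap (h : SpinCover π z) {a b c d : α} (hnd : [a, b, c, d].Nodup)
    {x y : G} (hx : Perm.sign (π x) = 1) (hxa : π x a = b) (hxb : π x b = a) (hxc : π x c = d)
    (hxd : π x d = c) (hy : π y = swap a c * swap b d) : y * x = z * (x * y) := by
  obtain ⟨s, hs⟩ := h.surj (swap a b)
  obtain ⟨t, ht⟩ := h.surj (swap c d)
  have hst := h.anti a b c d hnd s t hs ht
  simp only [List.nodup_cons, List.mem_cons, List.not_mem_nil, or_false, not_or, List.nodup_nil,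
    and_true, not_false_eq_true] at hnd
  obtain ⟨⟨hab, hac, had⟩, ⟨hbc, hbd⟩, hcd⟩ := hnd
  have hv : ∀ e, (e = a ∨ e = b ∨ e = c ∨ e = d) → π ((s * t)⁻¹ * x) e = e := by
    intro e he
    rw [map_mul, map_inv, map_mul, hs, ht, mul_inv_rev, swap_inv, swap_inv, Perm.mul_apply,
      Perm.mul_apply]
    rcases he with rfl | rfl | rfl | rfl
    · rw [hxa, swap_apply_right, swap_apply_of_ne_of_ne hac had]
    · rw [hxb, swap_apply_left, swap_apply_of_ne_of_ne hbc hbd]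
    · rw [hxc, swap_apply_of_ne_of_ne (Ne.symm had) (Ne.symm hbd), swap_apply_right]
    · rw [hxd, swap_apply_of_ne_of_ne (Ne.symm hac) (Ne.symm hbc), swap_apply_left]
  have hve : Perm.sign (π ((s * t)⁻¹ * x)) = 1 := by
    rw [map_mul, map_mul, map_inv, map_inv, map_mul, map_mul, hs, ht, Perm.sign_swap hab,
      Perm.sign_swap hcd, hx]
    rfl
  have hvy : Commute y ((s * t)⁻¹ * x) := by
    refine h.commute_of_even hve fun e he => hv e ?_
    by_contra hne
    push Not at hne
    apply he
    rw [hy, Perm.mul_apply, swap_apply_of_ne_of_ne hne.2.1 hne.2.2.2,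
      swap_apply_of_ne_of_ne hne.1 hne.2.2.1]
  have hxv : x = s * t * ((s * t)⁻¹ * x) := by group
  generalize (s * t)⁻¹ * x = v at *
  have hyy : Commute (y * y) s := by
    refine h.commute_of_map_eq_one ?_ s
    have : Commute (swap a c) (swap b d) := by
      have : Perm.Disjoint (swap a c) (swap b d) := by
        rw [Perm.disjoint_iff_disjoint_support, Perm.support_swap hac, Perm.support_swap hbd]
        simp [Ne.symm hab, Ne.symm had, hbc, Ne.symm hcd]
      exact this.commute
    rw [map_mul, hy, mul_assoc, ← mul_assoc (swap b d), ← this.eq, mul_assoc, swap_mul_self,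
      mul_one, swap_mul_self]
  have hys : π (y * s * y⁻¹) = π t := by
    rw [map_mul, map_mul, map_inv, hs, ht, ← swap_apply_apply, hy, Perm.mul_apply, Perm.mul_apply,
      swap_apply_of_ne_of_ne hab had, swap_apply_left, swap_apply_left,
      swap_apply_of_ne_of_ne (Ne.symm had) (Ne.symm hcd)]
  have hyst : y * (s * t) = z * (s * t * y) := by
    rcases h.eq_or_of_map_eq hys with h1 | h1
    · have h2 : y * s = t * y := by rw [← h1, inv_mul_cancel_right]
      have h3 : y * t = s * y := by
        have : y * t * y = s * y * y := by rw [mul_assoc, ← h2, ← mul_assoc, hyy.eq, mul_assoc]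
        exact mul_right_cancel this
      rw [← mul_assoc, h2, mul_assoc, h3, ← mul_assoc, ← mul_assoc, hst, h.z_mul_z]
    · have h2 : y * s = z * (t * y) := by rw [← mul_assoc, ← h1, inv_mul_cancel_right]
      have h3 : y * t = z * (s * y) := by
        have : y * t * y = z * (s * y) * y := by
          have : y * (y * s) = y * (z * (t * y)) := by rw [h2]
          rw [h.mul_z, ← mul_assoc, hyy.eq] at this
          rw [mul_assoc z, mul_assoc s, this, h.z_mul_z, mul_assoc]
        exact mul_right_cancel this
      rw [← mul_assoc, h2, mul_assoc z, mul_assoc t, h3, h.mul_z, h.z_mul_z, ← mul_assoc,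
        ← mul_assoc, hst, h.z_mul_z]
  rw [hxv, ← mul_assoc, hyst, mul_assoc z, mul_assoc (s * t), hvy.eq, ← mul_assoc (s * t)]

omit [Fintype α]

lemma exists_lift_pow_eq_one (h : SpinCover π z) {σ : Perm α} {q : ℕ} (hq : Odd q)
    (hσ : σ ^ q = 1) : ∃ c, π c = σ ∧ c ^ q = 1 := by
  obtain ⟨c, rfl⟩ := h.surj σ
  rcases h.ker (c ^ q) (by rw [map_pow, hσ]) with h1 | h1
  · exact ⟨c, rfl, h1⟩
  · refine ⟨z * c, by rw [map_mul, h.map_z, one_mul], ?_⟩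
    have hc : Commute z c := h.central c
    obtain ⟨k, rfl⟩ := hq
    rw [hc.mul_pow, h1, pow_succ, pow_mul, pow_two, h.sq, one_pow, one_mul, h.sq]

lemma eq_of_pow_eq_one (h : SpinCover π z) (hz : z ≠ 1) {x y : G} {q : ℕ} (hq : Odd q)
    (hx : x ^ q = 1) (hy : y ^ q = 1) (hxy : π x = π y) : x = y := by
  rcases h.eq_or_of_map_eq hxy with h1 | rfl
  · exact h1
  · have hc : Commute z y := h.central y
    obtain ⟨k, rfl⟩ := hq
    rw [hc.mul_pow, hy, pow_succ, pow_mul, pow_two, h.sq, one_pow, one_mul, mul_one] at hx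
    exact absurd hx hz

end SpinCover

lemma Equiv.Perm.sign_eq_one_of_odd_pow {α : Type*} [DecidableEq α] [Fintype α]
    {σ : Equiv.Perm α} {q : ℕ} (hq : Odd q) (hσ : σ ^ q = 1) : Equiv.Perm.sign σ = 1 := by
  have h1 : Equiv.Perm.sign σ ^ q = 1 := by rw [← map_pow, hσ, map_one]
  rcases Int.units_eq_one_or (Equiv.Perm.sign σ) with h | h
  · exact h
  · rw [h, hq.neg_one_pow] at h1
    exact absurd h1 (by decide)

section Spectral

open ZMod Module

variable {V : Type*} [AddCommGroup V] [Module ℂ V] {N : ℕ} [NeZero N] {X : End ℂ V}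

lemma pow_val_add {M : Type*} [Monoid M] {x : M} (hx : x ^ N = 1) (a b : ZMod N) :
    x ^ (a + b).val = x ^ a.val * x ^ b.val := by
  rw [ZMod.val_add, ← pow_eq_pow_mod _ hx, pow_add]

omit [NeZero N] in
lemma pow_val_natCast {M : Type*} [Monoid M] {x : M} (hx : x ^ N = 1) (a : ℕ) :
    x ^ (a : ZMod N).val = x ^ a := by
  rw [ZMod.val_natCast, ← pow_eq_pow_mod _ hx]

/-- The projection onto the eigenspace of `X` for the eigenvalue `stdAddChar s`, where
`X ^ N = 1`. -/
noncomputable def eigenProj (N : ℕ) [NeZero N] (X : End ℂ V) (s : ZMod N) : End ℂ V :=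
  (N : ℂ)⁻¹ • ∑ j : ZMod N, stdAddChar (-(s * j)) • X ^ j.val

lemma pow_mul_eigenProj (hX : X ^ N = 1) (k s : ZMod N) :
    X ^ k.val * eigenProj N X s = stdAddChar (s * k) • eigenProj N X s := by
  rw [eigenProj, mul_smul_comm, smul_comm]
  congr 1
  rw [Finset.mul_sum, Finset.smul_sum]
  refine Fintype.sum_equiv (Equiv.addLeft k) _ _ fun j => ?_
  rw [mul_smul_comm, ← pow_val_add hX, smul_smul, ← AddChar.map_add_eq_mul, Equiv.coe_addLeft]
  congr 2
  ring

lemma mul_eigenProj (hX : X ^ N = 1) (s : ZMod N) :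
    X * eigenProj N X s = stdAddChar s • eigenProj N X s := by
  have := pow_mul_eigenProj hX 1 s
  rwa [mul_one, ← Nat.cast_one, pow_val_natCast hX, pow_one] at this

lemma exists_stdAddChar_eq {μ : ℂ} (hμ : μ ^ N = 1) : ∃ s : ZMod N, stdAddChar s = μ := by
  obtain ⟨k, -, hk⟩ := (Complex.isPrimitiveRoot_exp N (NeZero.ne N)).eq_pow_of_pow_eq_one hμ
  refine ⟨(k : ZMod N), ?_⟩
  rw [← hk, ← Int.cast_natCast, ZMod.stdAddChar_coe, ← Complex.exp_nat_mul]
  congr 1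
  push_cast
  ring

lemma sum_eigenProj (X : End ℂ V) : ∑ s, eigenProj N X s = 1 := by
  have hN : (N : ℂ) ≠ 0 := Nat.cast_ne_zero.mpr (NeZero.ne N)
  simp only [eigenProj]
  rw [← Finset.smul_sum, Finset.sum_comm]
  have : ∀ j : ZMod N, ∑ s : ZMod N, stdAddChar (-(s * j)) • X ^ j.val =
      if j = 0 then (N : ℂ) • (1 : End ℂ V) else 0 := by
    intro j
    rw [← Finset.sum_smul]
    have h1 := AddChar.sum_mulShift (-j) (isPrimitive_stdAddChar N)
    simp only [mul_neg, neg_eq_zero] at h1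
    rw [h1]
    split_ifs with h
    · rw [h, ZMod.card, ZMod.val_zero, pow_zero]
    · simp
  simp only [this, Finset.sum_ite_eq', Finset.mem_univ, if_true]
  rw [smul_smul, inv_mul_cancel₀ hN, one_smul]

lemma isIdempotentElem_eigenProj (hX : X ^ N = 1) (s : ZMod N) :
    IsIdempotentElem (eigenProj N X s) := by
  have hN : (N : ℂ) ≠ 0 := Nat.cast_ne_zero.mpr (NeZero.ne N)
  rw [IsIdempotentElem]
  conv_lhs => enter [1]; rw [eigenProj]
  rw [smul_mul_assoc, Finset.sum_mul]
  simp only [smul_mul_assoc, pow_mul_eigenProj hX, smul_smul, ← AddChar.map_add_eq_mul,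
    neg_add_cancel, AddChar.map_zero_eq_one, one_smul]
  rw [Finset.sum_const, Finset.card_univ, ZMod.card, ← Nat.cast_smul_eq_nsmul ℂ, smul_smul,
    inv_mul_cancel₀ hN, one_smul]

lemma pow_eq_sum_eigenProj (hX : X ^ N = 1) (k : ZMod N) :
    X ^ k.val = ∑ s, stdAddChar (s * k) • eigenProj N X s := by
  rw [← mul_one (X ^ k.val), ← sum_eigenProj (N := N) X, Finset.mul_sum]
  exact Finset.sum_congr rfl fun s _ => pow_mul_eigenProj hX k s

lemma eigenProj_commute {X Y : End ℂ V} (h : Commute X Y) (s : ZMod N) :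
    Commute (eigenProj N X s) Y :=
  (Commute.sum_left _ _ _ fun j _ => (h.pow_left j.val).smul_left _).smul_left _

/-- Some eigenprojection does not annihilate a given nonzero vector. -/
lemma exists_eigenProj_ne_zero {v : V} (hv : v ≠ 0) (X : End ℂ V) :
    ∃ s : ZMod N, eigenProj N X s v ≠ 0 := by
  by_contra! h
  apply hv
  have := congrArg (fun f : End ℂ V => f v) (sum_eigenProj (N := N) X)
  simpa [LinearMap.sum_apply, h] using this.symm

lemma exists_eigenProj_ne_zero_of_ne {v : V} (hX : X ^ N = 1) (hv : X v ≠ v) :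
    ∃ s : ZMod N, s ≠ 0 ∧ eigenProj N X s v ≠ 0 := by
  by_contra! h
  have h1 : eigenProj N X 0 v = v := by
    have := congrArg (fun f : End ℂ V => f v) (sum_eigenProj (N := N) X)
    simp only [LinearMap.sum_apply, Module.End.one_apply] at this
    rwa [Finset.sum_eq_single 0 (fun s _ hs => h s hs) (by simp)] at this
  have h2 := congrArg (fun f : End ℂ V => f v) (mul_eigenProj hX 0)
  simp only [Module.End.mul_apply, h1, AddChar.map_zero_eq_one, one_smul] at h2
  exact hv h2

variable [FiniteDimensional ℂ V]

/-- The multiplicity of the eigenvalue `stdAddChar s` of `X`. -/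
noncomputable def eigenMult (N : ℕ) [NeZero N] (X : End ℂ V) (s : ZMod N) : ℕ :=
  finrank ℂ (LinearMap.range (eigenProj N X s))

lemma trace_eigenProj (hX : X ^ N = 1) (s : ZMod N) :
    LinearMap.trace ℂ V (eigenProj N X s) = eigenMult N X s :=
  (LinearMap.IsIdempotentElem.isProj_range _ (isIdempotentElem_eigenProj hX s)).trace

lemma trace_pow_eq_sum (hX : X ^ N = 1) (k : ZMod N) :
    LinearMap.trace ℂ V (X ^ k.val) = ∑ s, eigenMult N X s * stdAddChar (s * k) := by
  rw [pow_eq_sum_eigenProj hX, map_sum]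
  refine Finset.sum_congr rfl fun s _ => ?_
  rw [_root_.map_smul, trace_eigenProj hX, smul_eq_mul, mul_comm]

omit [FiniteDimensional ℂ V] in
lemma exists_eigenvector_of_eigenMult_ne_zero (hX : X ^ N = 1) {s : ZMod N}
    (hs : eigenMult N X s ≠ 0) : ∃ v ≠ 0, X v = stdAddChar s • v := by
  have : LinearMap.range (eigenProj N X s) ≠ ⊥ := fun h => hs (by
    rw [eigenMult, h, finrank_bot])
  obtain ⟨_, ⟨w, rfl⟩, hv⟩ := Submodule.exists_mem_ne_zero_of_ne_bot this
  exact ⟨_, hv, congrArg (fun f : End ℂ V => f w) (mul_eigenProj hX s)⟩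

lemma eigenMult_eq (hX : X ^ N = 1) (s : ZMod N) : (eigenMult N X s : ℂ) =
    (N : ℂ)⁻¹ * ∑ j : ZMod N, stdAddChar (-(s * j)) * LinearMap.trace ℂ V (X ^ j.val) := by
  rw [← trace_eigenProj hX, eigenProj, _root_.map_smul, map_sum, smul_eq_mul]
  simp only [_root_.map_smul, smul_eq_mul]

end Spectral

/-- `R` restricts to a spin representation of the preimage of the alternating group. -/
structure EvenRep {G α V : Type*} [Group G] [DecidableEq α] [Fintype α] [AddCommGroup V]
    [Module ℂ V] (π : G →* Equiv.Perm α) (z : G) (R : G → Module.End ℂ V) : Prop where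
  one : R 1 = 1
  mul : ∀ x y, Equiv.Perm.sign (π x) = 1 → Equiv.Perm.sign (π y) = 1 → R (x * y) = R x * R y
  spin : R z = -1

section Weights

variable {q l : ℕ}

lemma natCast_ne_zero_of_lt {a : ℕ} (h0 : 0 < a) (h : a < l) : (a : ZMod l) ≠ 0 := by
  rw [Ne, ZMod.natCast_eq_zero_iff]
  exact Nat.not_dvd_of_pos_of_lt h0 h

lemma one_ne_zero_zmod (hl : 3 ≤ l) : (1 : ZMod l) ≠ 0 := by
  simpa using natCast_ne_zero_of_lt (l := l) (a := 1) one_pos (by omega)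

lemma two_ne_zero_zmod (hl : 3 ≤ l) : (2 : ZMod l) ≠ 0 := by
  simpa using natCast_ne_zero_of_lt (l := l) (a := 2) two_pos (by omega)

lemma two_ne_one_zmod (hl : 3 ≤ l) : (2 : ZMod l) ≠ 1 := by
  intro h
  apply one_ne_zero_zmod hl
  linear_combination h

variable [Fact q.Prime] [NeZero l]

/-- The function with prescribed values at `0`, `1`, `2` and the value `1` elsewhere. -/
def threeThenOnes (l q : ℕ) (a b c : ZMod q) (i : ZMod l) : ZMod q :=
  if i = 0 then a else if i = 1 then b else if i = 2 then c else 1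

lemma sum_threeThenOnes (hl : 3 ≤ l) (a b c : ZMod q) :
    ∑ i, threeThenOnes l q a b c i = a + b + c + (l - 3) := by
  have h1 := one_ne_zero_zmod hl
  have h2 := two_ne_zero_zmod hl
  have h3 := two_ne_one_zmod hl
  have : ∀ i : ZMod l, threeThenOnes l q a b c i =
      (if i = 0 then a - 1 else 0) + (if i = 1 then b - 1 else 0) +
      (if i = 2 then c - 1 else 0) + 1 := by
    intro i
    unfold threeThenOnes
    split_ifs <;> simp_all
  simp only [this, Finset.sum_add_distrib, Finset.sum_ite_eq', Finset.mem_univ, if_true,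
    Finset.sum_const, Finset.card_univ, ZMod.card, nsmul_eq_mul, mul_one]
  ring

lemma prod_threeThenOnes (hl : 3 ≤ l) (a b c : ZMod q) :
    ∏ i, threeThenOnes l q a b c i = a * b * c := by
  have h1 := one_ne_zero_zmod hl
  have h2 := two_ne_zero_zmod hl
  have h3 := two_ne_one_zmod hl
  have : ∀ i : ZMod l, threeThenOnes l q a b c i =
      (if i = 0 then a else 1) * (if i = 1 then b else 1) * (if i = 2 then c else 1) := by
    intro i
    unfold threeThenOnes
    split_ifs <;> simp_all
  simp only [this, Finset.prod_mul_distrib, Finset.prod_ite_eq', Finset.mem_univ, if_true]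

omit [NeZero l] in
lemma exists_add_eq (hq : 3 ≤ q) (t : ZMod q) : ∃ a b : ZMod q, a ≠ 0 ∧ b ≠ 0 ∧ a + b = t := by
  by_cases ht : t = 0
  · exact ⟨1, -1, one_ne_zero, neg_ne_zero.mpr one_ne_zero, by rw [ht, add_neg_cancel]⟩
  · exact ⟨2 * t, -t, mul_ne_zero (two_ne_zero_zmod hq) ht, neg_ne_zero.mpr ht, by ring⟩

lemma exists_weight_zero (hq : 3 ≤ q) (hl : 3 ≤ l) (s : ZMod q) : ∃ w : ZMod l → ZMod q,
    w 0 = 0 ∧ (∀ i, i ≠ 0 → w i ≠ 0) ∧ ∑ i, w i = s ∧ ∀ r, (∀ i, w (i + r) = w i) → r = 0 := by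
  obtain ⟨a, b, ha, hb, hab⟩ := exists_add_eq hq (s - (l - 3))
  have hne : ∀ i, i ≠ 0 → threeThenOnes l q 0 a b i ≠ 0 := by
    intro i hi
    unfold threeThenOnes
    split_ifs <;> simp_all
  refine ⟨threeThenOnes l q 0 a b, by simp [threeThenOnes], hne, ?_, ?_⟩
  · rw [sum_threeThenOnes hl]
    linear_combination hab
  · intro r hr
    by_contra h
    apply hne r h
    have := hr 0
    rw [zero_add] at this
    rw [this]
    simp [threeThenOnes]

lemma exists_square_multiple (hq : 5 ≤ q) {P : ZMod q} (hP : P ≠ 0) (t : ZMod q) :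
    ∃ y : ZMod q, y ≠ 0 ∧ P * (y * y) ≠ t ∧ 3 * (P * (y * y)) ≠ t := by
  have hp : q.Prime := Fact.out
  have h2 : (2 : ZMod q) ≠ 0 := two_ne_zero_zmod (by omega)
  have h3 : (3 : ZMod q) ≠ 0 := by
    simpa using natCast_ne_zero_of_lt (l := q) (a := 3) (by omega) (by omega)
  have h4 : (4 : ZMod q) ≠ 0 := by
    simpa using natCast_ne_zero_of_lt (l := q) (a := 4) (by omega) (by omega)
  by_contra! h
  have a1 := h 1 one_ne_zero
  have a2 := h 2 h2
  have a3 := h 4 h4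
  have k3 : ∀ x : ZMod q, 3 * x = 0 → x = 0 := fun x hx => (mul_eq_zero.mp hx).resolve_left h3
  by_cases b1 : P * (1 * 1) = t
  · by_cases b2 : P * (2 * 2) = t
    · exact hP (k3 P (by linear_combination b2 - b1))
    · have b2' := a2 b2
      have h11 : 11 * P = 0 := by linear_combination b2' - b1
      by_cases b3 : P * (4 * 4) = t
      · exact hP (by linear_combination 3 * (b3 - b1) - 4 * h11)
      · have b3' := a3 b3
        have h47 : 47 * P = 0 := by linear_combination b3' - b1
        exact hP (k3 P (by linear_combination h47 - 4 * h11))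
  · have b1' := a1 b1
    by_cases b2 : P * (2 * 2) = t
    · exact hP (by linear_combination b2 - b1')
    · have b2' := a2 b2
      exact hP (k3 P (k3 _ (by linear_combination b2' - b1')))

lemma exists_weight_of_five_le (hq : 5 ≤ q) (hl : 3 ≤ l) (s : ZMod q) {P : ZMod q} (hP : P ≠ 0) :
    ∃ w : ZMod l → ZMod q, (∀ i, w i ≠ 0) ∧ IsSquare (P * ∏ i, w i) ∧ ∑ i, w i = s ∧
      ∀ r, (∀ i, w (i + r) = w i) → r = 0 := by
  have h1 := one_ne_zero_zmod hl
  have h2 := two_ne_zero_zmod hl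
  have h3 := two_ne_one_zmod hl
  have hq2 : (2 : ZMod q) ≠ 0 := two_ne_zero_zmod (by omega)
  obtain ⟨y, hy, hy1, hy2⟩ := exists_square_multiple hq hP (s - (l - 3))
  set v := P * (y * y) with hv
  obtain ⟨b, hb⟩ : ∃ b : ZMod q, 2 * b = s - (l - 3) - v :=
    ⟨(s - (l - 3) - v) / 2, mul_div_cancel₀ _ hq2⟩
  have hv0 : v ≠ 0 := mul_ne_zero hP (mul_ne_zero hy hy)
  have hb0 : b ≠ 0 := by
    rintro rfl
    exact hy1 (by linear_combination hb)
  have hbv : b ≠ v := by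
    intro h
    exact hy2 (by rw [h] at hb; linear_combination hb)
  refine ⟨threeThenOnes l q v b b, ?_, ?_, ?_, ?_⟩
  · intro i
    unfold threeThenOnes
    split_ifs <;> simp_all
  · rw [prod_threeThenOnes hl]
    exact ⟨P * y * b, by rw [hv]; ring⟩
  · rw [sum_threeThenOnes hl]
    linear_combination hb
  · intro r hr
    by_cases hb1 : b = 1
    · have h0 := hr 0
      rw [zero_add] at h0
      by_contra hr0
      apply hbv
      have hv1 : threeThenOnes l q v b b 0 = v := by simp [threeThenOnes]
      rw [hv1] at h0
      rw [← h0]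
      unfold threeThenOnes
      rw [if_neg hr0]
      split_ifs <;> simp_all
    · have key : ∀ i, threeThenOnes l q v b b i = b → threeThenOnes l q v b b (i + 1) ≠ b →
          i = 2 := by
        intro i hi hi1
        by_contra hi2
        by_cases e0 : i = 0
        · rw [e0] at hi
          simp only [threeThenOnes, if_true] at hi
          exact hbv hi.symm
        by_cases e1 : i = 1
        · apply hi1
          have h4 : i + 1 = 2 := by rw [e1]; norm_num
          rw [h4]
          simp [threeThenOnes, h2, h3]
        · simp only [threeThenOnes, if_neg e0, if_neg e1, if_neg hi2] at hi
          exact hb1 hi.symm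
      have e2 : threeThenOnes l q v b b 2 = b := by simp [threeThenOnes, h2, h3]
      have e3 : threeThenOnes l q v b b (2 + 1) ≠ b := by
        unfold threeThenOnes
        rw [if_neg (show (2 : ZMod l) + 1 ≠ 1 by simpa using h2),
          if_neg (show (2 : ZMod l) + 1 ≠ 2 by simpa using h1)]
        split_ifs
        · exact hbv.symm
        · exact Ne.symm hb1
      have := key (2 + r) (by rw [hr, e2]) (by rw [add_right_comm, hr]; exact e3)
      simpa using this

lemma exists_weight_three (hl : 7 ≤ l) (s : ZMod 3) {P : ZMod 3} (hP : P ≠ 0) :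
    ∃ w : ZMod l → ZMod 3, (∀ i, w i ≠ 0) ∧ IsSquare (P * ∏ i, w i) ∧ ∑ i, w i = s ∧
      ∀ r, (∀ i, w (i + r) = w i) → r = 0 := by
  obtain ⟨k, hk0, hk6, hkP, hks⟩ : ∃ k : ℕ, 0 < k ∧ k < 7 ∧ P * (-1) ^ k = 1 ∧
      (k : ZMod 3) = s - l := by
    have : ∀ P t : ZMod 3, P ≠ 0 → ∃ k : Fin 7, 0 < k.val ∧ P * (-1) ^ k.val = 1 ∧
      (k.val : ZMod 3) = t := by decide
    obtain ⟨k, h1, h2, h3⟩ := this P (s - l) hP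
    exact ⟨k, h1, k.2, h2, h3⟩
  have hcard : (Finset.univ.filter fun i : ZMod l => i.val < k).card = k := by
    have : (Finset.univ.filter fun i : ZMod l => i.val < k) =
        (Finset.range k).image (fun j : ℕ => (j : ZMod l)) := by
      ext i
      simp only [Finset.mem_filter, Finset.mem_univ, true_and, Finset.mem_image, Finset.mem_range]
      constructor
      · intro hi
        exact ⟨i.val, hi, ZMod.natCast_zmod_val i⟩
      · rintro ⟨j, hj, rfl⟩
        rwa [ZMod.val_natCast, Nat.mod_eq_of_lt (by omega)]
    rw [this, Finset.card_image_of_injOn, Finset.card_range]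
    intro a ha b hb hab
    have ha' : a < k := by simpa using ha
    have hb' : b < k := by simpa using hb
    have := congrArg ZMod.val hab
    simpa [ZMod.val_natCast, Nat.mod_eq_of_lt (show a < l by omega),
      Nat.mod_eq_of_lt (show b < l by omega)] using this
  refine ⟨fun i => if i.val < k then -1 else 1, ?_, ?_, ?_, ?_⟩
  · intro i
    dsimp only
    split_ifs <;> decide
  · rw [Finset.prod_ite, Finset.prod_const, Finset.prod_const, hcard, one_pow, mul_one, hkP]
    exact ⟨1, by norm_num⟩
  · have : ∀ i : ZMod l, (if i.val < k then (-1 : ZMod 3) else 1) =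
        (if i.val < k then 1 else 0) + 1 := by
      intro i
      split_ifs <;> decide
    simp only [this, Finset.sum_add_distrib, Finset.sum_const, Finset.card_univ, ZMod.card,
      nsmul_eq_mul, mul_one]
    rw [← Finset.sum_filter, Finset.sum_const, hcard, nsmul_eq_mul, mul_one, hks]
    ring
  · intro r hr
    have key : ∀ i : ZMod l, i.val < k → ¬ (i + 1).val < k → i.val + 1 = k := by
      intro i hi hi1
      rw [ZMod.val_add] at hi1
      have h1 : (1 : ZMod l).val = 1 := by
        have := ZMod.val_natCast l 1
        rwa [Nat.cast_one, Nat.mod_eq_of_lt (by omega)] at this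
      rw [h1, Nat.mod_eq_of_lt (by omega)] at hi1
      omega
    have hiff : ∀ i : ZMod l, (i + r).val < k ↔ i.val < k := by
      intro i
      have := hr i
      dsimp only at this
      by_cases h1 : (i + r).val < k <;> by_cases h2 : i.val < k <;>
        simp only [h1, h2, if_true, if_false] at this ⊢ <;> revert this <;> decide
    have hv : ((k - 1 : ℕ) : ZMod l).val = k - 1 := by
      rw [ZMod.val_natCast, Nat.mod_eq_of_lt (by omega)]
    have hv1 : ((k - 1 : ℕ) + 1 : ZMod l).val = k := by
      rw [← Nat.cast_succ, Nat.succ_eq_add_one, Nat.sub_add_cancel hk0, ZMod.val_natCast,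
        Nat.mod_eq_of_lt (by omega)]
    have h1 := key (((k - 1 : ℕ) : ZMod l) + r) ((hiff _).mpr (by omega)) (by
      rw [add_right_comm, hiff, hv1]; omega)
    have h2 : (((k - 1 : ℕ) : ZMod l) + r).val = ((k - 1 : ℕ) : ZMod l).val := by omega
    simpa using ZMod.val_injective l h2

/-- A family of weights stable under rescalings of square determinant, containing one that
vanishes at most at `0`, contains aperiodic weights of every sum. -/
lemma exists_aperiodic_weight (hql : (5 ≤ q ∧ 3 ≤ l) ∨ (q = 3 ∧ 7 ≤ l))
    (Ω : Set (ZMod l → ZMod q)) (hΩ : ∀ w ∈ Ω, ∀ u : ZMod l → (ZMod q)ˣ, IsSquare (∏ i, u i) →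
      (fun i => (u i : ZMod q) * w i) ∈ Ω)
    {w : ZMod l → ZMod q} (hw : w ∈ Ω) (hw0 : ∀ i, i ≠ 0 → w i ≠ 0) (s : ZMod q) :
    ∃ w' ∈ Ω, ∑ i, w' i = s ∧ ∀ r, (∀ i, w' (i + r) = w' i) → r = 0 := by
  by_cases h0 : w 0 = 0
  · obtain ⟨w', h1, h2, h3, h4⟩ := exists_weight_zero (q := q) (l := l) (by omega) (by omega) s
    refine ⟨w', ?_, h3, h4⟩
    let u : ZMod l → (ZMod q)ˣ := fun i =>
      if h : i = 0 then 1 else Units.mk0 (w' i / w i) (div_ne_zero (h2 i h) (hw0 i h))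
    let u' : ZMod l → (ZMod q)ˣ := fun i => if i = 0 then (∏ j, u j)⁻¹ else u i
    have hprod : ∏ i, u' i = 1 := by
      have : ∀ i, u' i = (if i = 0 then (∏ j, u j)⁻¹ else 1) * u i := by
        intro i
        by_cases hi : i = 0 <;> simp [u', u, hi]
      simp only [this, Finset.prod_mul_distrib, Finset.prod_ite_eq', Finset.mem_univ, if_true,
        inv_mul_cancel]
    have := hΩ w hw u' (hprod ▸ IsSquare.one)
    convert this using 1
    ext i
    by_cases hi : i = 0
    · rw [hi, h1, h0, mul_zero]
    · simp only [u', u, if_neg hi, dif_neg hi, Units.val_mk0]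
      rw [div_mul_cancel₀ _ (hw0 i hi)]
  · have hw1 : ∀ i, w i ≠ 0 := fun i => by
      by_cases hi : i = 0
      · rwa [hi]
      · exact hw0 i hi
    have hP : ∏ i, w i ≠ 0 := Finset.prod_ne_zero_iff.mpr fun i _ => hw1 i
    obtain ⟨w', h1, ⟨y, hy⟩, h3, h4⟩ : ∃ w' : ZMod l → ZMod q, (∀ i, w' i ≠ 0) ∧
        IsSquare ((∏ i, w i) * ∏ i, w' i) ∧ ∑ i, w' i = s ∧
        ∀ r, (∀ i, w' (i + r) = w' i) → r = 0 := by
      rcases hql with ⟨h5, hl⟩ | ⟨rfl, hl⟩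
      · exact exists_weight_of_five_le h5 hl s hP
      · exact exists_weight_three hl s hP
    refine ⟨w', ?_, h3, h4⟩
    have hy0 : y ≠ 0 := by
      rintro rfl
      rw [mul_zero] at hy
      exact mul_ne_zero hP (Finset.prod_ne_zero_iff.mpr fun i _ => h1 i) hy
    have := hΩ w hw (fun i => Units.mk0 (w' i / w i) (div_ne_zero (h1 i) (hw1 i)))
      ⟨Units.mk0 (y / ∏ i, w i) (div_ne_zero hy0 hP), by
        ext
        simp only [Units.coe_prod, Units.val_mk0, Units.val_mul, Finset.prod_div_distrib]
        rw [div_mul_div_comm, ← hy, mul_div_mul_left _ _ hP]⟩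
    convert this using 1
    ext i
    simp only [Units.val_mk0]
    rw [div_mul_cancel₀ _ (hw1 i)]

end Weights

lemma eq_zero_of_eq_neg_self {V : Type*} [AddCommGroup V] [Module ℂ V] {v : V} (h : v = -v) :
    v = 0 := by
  have h2 : (2 : ℂ) • v = 0 := by
    rw [two_smul]
    nth_rewrite 2 [h]
    exact add_neg_cancel v
  exact (smul_eq_zero.mp h2).resolve_left two_ne_zero

lemma mem_of_double_swap_ne {α : Type*} [DecidableEq α] {H : Set α} {a b c d x : α} (ha : a ∈ H)
    (hb : b ∈ H) (hc : c ∈ H) (hd : d ∈ H)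
    (hx : (Equiv.swap a b * Equiv.swap c d : Equiv.Perm α) x ≠ x) : x ∈ H := by
  by_contra hne
  apply hx
  have h1 : x ≠ a := fun e => hne (e ▸ ha)
  have h2 : x ≠ b := fun e => hne (e ▸ hb)
  have h3 : x ≠ c := fun e => hne (e ▸ hc)
  have h4 : x ≠ d := fun e => hne (e ▸ hd)
  rw [Equiv.Perm.mul_apply, Equiv.swap_apply_of_ne_of_ne h3 h4,
    Equiv.swap_apply_of_ne_of_ne h1 h2]

namespace EvenRep

open Equiv

variable {G α V : Type*} [Group G] [DecidableEq α] [Fintype α] [AddCommGroup V] [Module ℂ V]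
  {π : G →* Perm α} {z : G} {R : G → Module.End ℂ V}

lemma pow (hR : EvenRep π z R) {x : G} (hx : Perm.sign (π x) = 1) (k : ℕ) :
    R (x ^ k) = R x ^ k := by
  induction k with
  | zero => rw [pow_zero, pow_zero, hR.one]
  | succ k ih =>
    rw [pow_succ, pow_succ, hR.mul _ _ (by rw [map_pow, map_pow, hx, one_pow]) hx, ih]

lemma sign_inv {x : G} (hx : Perm.sign (π x) = 1) : Perm.sign (π x⁻¹) = 1 := by
  rw [map_inv, Perm.sign_inv, hx]

lemma sign_mul {x y : G} (hx : Perm.sign (π x) = 1) (hy : Perm.sign (π y) = 1) :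
    Perm.sign (π (x * y)) = 1 := by
  rw [map_mul, Perm.sign_mul, hx, hy, one_mul]

lemma inv_mul_self (hR : EvenRep π z R) {x : G} (hx : Perm.sign (π x) = 1) :
    R x⁻¹ * R x = 1 := by
  rw [← hR.mul _ _ (sign_inv hx) hx, inv_mul_cancel, hR.one]

lemma apply_ne_zero (hR : EvenRep π z R) {x : G} (hx : Perm.sign (π x) = 1) {v : V} (hv : v ≠ 0) :
    R x v ≠ 0 := by
  intro h
  apply hv
  have := congrArg (fun f : Module.End ℂ V => f v) (hR.inv_mul_self hx)
  simpa [h] using this.symm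

lemma commute (hR : EvenRep π z R) {x y : G} (hx : Perm.sign (π x) = 1) (hy : Perm.sign (π y) = 1)
    (hxy : Commute x y) : Commute (R x) (R y) := by
  rw [Commute, SemiconjBy, ← hR.mul _ _ hx hy, ← hR.mul _ _ hy hx, hxy.eq]

lemma map_z_mul (hR : EvenRep π z R) (h : SpinCover π z) {x : G} (hx : Perm.sign (π x) = 1) :
    R (z * x) = - R x := by
  rw [hR.mul _ _ (by rw [h.map_z, map_one]) hx, hR.spin, neg_one_mul]

lemma z_ne_one (hR : EvenRep π z R) [Nontrivial V] : z ≠ 1 := by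
  rintro rfl
  have h := hR.spin
  rw [hR.one] at h
  obtain ⟨v, hv⟩ := exists_ne (0 : V)
  have h1 := congrArg (fun f : Module.End ℂ V => f v) h
  simp only [Module.End.one_apply, LinearMap.neg_apply] at h1
  exact hv (eq_zero_of_eq_neg_self h1)

/-- If a commutator of elements supported on `H` acts on two pairs of points by exchanging them,
then `c` acts nontrivially on any nonzero subspace stable under the elements supported on `H`. -/
lemma exists_apply_ne (hR : EvenRep π z R) (h : SpinCover π z) {X : Submodule ℂ V} (hX : X ≠ ⊥)
    {H : Set α} (hXH : ∀ y, Perm.sign (π y) = 1 → (∀ a, π y a ≠ a → a ∈ H) → ∀ u ∈ X, R y u ∈ X)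
    {c y : G} (hc : Perm.sign (π c) = 1) (hy : Perm.sign (π y) = 1)
    (hyH : ∀ a, π y a ≠ a → a ∈ H)
    {p₁ p₂ p₃ p₄ : α} (hnd : [p₁, p₂, p₃, p₄].Nodup) (h₁ : p₁ ∈ H) (h₂ : p₂ ∈ H) (h₃ : p₃ ∈ H)
    (h₄ : p₄ ∈ H) (hk : π (c * y * c⁻¹ * y⁻¹) = swap p₁ p₂ * swap p₃ p₄) :
    ∃ u ∈ X, R c u ≠ u := by
  by_contra! hfix
  have hyi : ∀ a, π y⁻¹ a ≠ a → a ∈ H := fun a ha => hyH a fun e => ha (by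
    rw [map_inv, Perm.inv_eq_iff_eq, e])
  have hci : ∀ u ∈ X, R c⁻¹ u = u := fun u hu => by
    have := congrArg (fun f : Module.End ℂ V => f u) (hR.inv_mul_self hc)
    simpa [hfix u hu] using this
  have hke : Perm.sign (π (c * y * c⁻¹ * y⁻¹)) = 1 := by
    simp [hc, hy]
  have hkfix : ∀ u ∈ X, R (c * y * c⁻¹ * y⁻¹) u = u := by
    intro u hu
    have h1 := hXH y⁻¹ (sign_inv hy) hyi u hu
    rw [hR.mul _ _ (sign_mul (sign_mul hc hy) (sign_inv hc)) (sign_inv hy),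
      hR.mul _ _ (sign_mul hc hy) (sign_inv hc), hR.mul _ _ hc hy]
    simp only [Module.End.mul_apply]
    have h2 := congrArg (fun f : Module.End ℂ V => f u) (hR.inv_mul_self (sign_inv hy))
    rw [inv_inv] at h2
    simp only [Module.End.mul_apply, Module.End.one_apply] at h2
    rw [hci _ h1, h2, hfix u hu]
  obtain ⟨w, hw⟩ := h.surj (swap p₁ p₃ * swap p₂ p₄)
  have hnd' := hnd
  simp only [List.nodup_cons, List.mem_cons, List.not_mem_nil, or_false, not_or, List.nodup_nil,
    and_true, not_false_eq_true] at hnd'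
  obtain ⟨⟨h12, h13, h14⟩, ⟨h23, h24⟩, h34⟩ := hnd'
  have hwe : Perm.sign (π w) = 1 := by
    rw [hw, Perm.sign_mul, Perm.sign_swap h13, Perm.sign_swap h24]; rfl
  have hwH : ∀ a, π w a ≠ a → a ∈ H := by
    rw [hw]
    exact fun a => mem_of_double_swap_ne h₁ h₃ h₂ h₄
  have hanti := h.anticommute_of_double_swap hnd hke
    (by rw [hk, Perm.mul_apply, swap_apply_of_ne_of_ne h13 h14, swap_apply_left])
    (by rw [hk, Perm.mul_apply, swap_apply_of_ne_of_ne h23 h24, swap_apply_right])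
    (by rw [hk, Perm.mul_apply, swap_apply_left,
      swap_apply_of_ne_of_ne (Ne.symm h14) (Ne.symm h24)])
    (by rw [hk, Perm.mul_apply, swap_apply_right,
      swap_apply_of_ne_of_ne (Ne.symm h13) (Ne.symm h23)]) hw
  obtain ⟨u, hu, hu0⟩ := Submodule.exists_mem_ne_zero_of_ne_bot hX
  have h1 : R (w * (c * y * c⁻¹ * y⁻¹)) u = R (z * ((c * y * c⁻¹ * y⁻¹) * w)) u := by rw [hanti]
  rw [hR.map_z_mul h (sign_mul hke hwe), hR.mul _ _ hwe hke, hR.mul _ _ hke hwe] at h1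
  simp only [Module.End.mul_apply, LinearMap.neg_apply, hkfix u hu,
    hkfix _ (hXH w hwe hwH u hu)] at h1
  exact hR.apply_ne_zero hwe hu0 (eq_zero_of_eq_neg_self h1)

lemma exists_apply_ne_of_five (hR : EvenRep π z R) (h : SpinCover π z) {X : Submodule ℂ V}
    (hX : X ≠ ⊥) {H : Set α}
    (hXH : ∀ y, Perm.sign (π y) = 1 → (∀ a, π y a ≠ a → a ∈ H) → ∀ u ∈ X, R y u ∈ X)
    {c : G} (hc : Perm.sign (π c) = 1) {p₁ p₂ p₃ p₄ d e : α}
    (hnd : [p₁, p₂, p₃, p₄, d, e].Nodup) (h₁ : p₁ ∈ H) (h₂ : p₂ ∈ H) (h₃ : p₃ ∈ H)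
    (h₄ : p₄ ∈ H) (hd : d ∈ H) (he : e ∈ H) (hc₁ : π c p₁ = p₂)
    (hc₃ : π c p₃ = p₄) (hcd : π c d = d) (hce : π c e = e) : ∃ u ∈ X, R c u ≠ u := by
  obtain ⟨y, hy⟩ := h.surj (swap p₁ p₃ * swap d e)
  simp only [List.nodup_cons, List.mem_cons, List.not_mem_nil, or_false, not_or, List.nodup_nil,
    and_true, not_false_eq_true] at hnd
  obtain ⟨⟨h12, h13, h14, h1d, h1e⟩, ⟨h23, h24, h2d, h2e⟩, ⟨h34, h3d, h3e⟩, ⟨h4d, h4e⟩, hde⟩ := hnd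
  have hye : Perm.sign (π y) = 1 := by
    rw [hy, Perm.sign_mul, Perm.sign_swap h13, Perm.sign_swap hde]; rfl
  have hyH : ∀ a, π y a ≠ a → a ∈ H := by
    rw [hy]
    exact fun a => mem_of_double_swap_ne h₁ h₃ hd he
  refine hR.exists_apply_ne h hX hXH hc hye hyH (p₁ := p₁) (p₂ := p₃) (p₃ := p₂) (p₄ := p₄)
    (by simp [h13, h12, h14, Ne.symm h23, h34, h24]) h₁ h₃ h₂ h₄ ?_
  have h5 : π (c * y * c⁻¹ * y⁻¹) = swap p₂ p₄ * swap d e * (swap p₁ p₃ * swap d e)⁻¹ := by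
    have : π c * (swap p₁ p₃ * swap d e) * (π c)⁻¹ =
      (π c * swap p₁ p₃ * (π c)⁻¹) * (π c * swap d e * (π c)⁻¹) := by group
    rw [map_mul, map_mul, map_mul, map_inv, map_inv, hy, this, ← swap_apply_apply,
      ← swap_apply_apply, hc₁, hc₃, hcd, hce]
  rw [h5, mul_inv_rev, swap_inv, swap_inv, mul_assoc, swap_mul_self_mul]
  have : Perm.Disjoint (swap p₂ p₄) (swap p₁ p₃) := by
    rw [Perm.disjoint_iff_disjoint_support, Perm.support_swap h24, Perm.support_swap h13]
    simp [h12, h14, Ne.symm h23, h34]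
  exact this.commute

lemma exists_apply_ne_of_three (hR : EvenRep π z R) (h : SpinCover π z) {X : Submodule ℂ V}
    (hX : X ≠ ⊥) {H : Set α}
    (hXH : ∀ y, Perm.sign (π y) = 1 → (∀ a, π y a ≠ a → a ∈ H) → ∀ u ∈ X, R y u ∈ X)
    {c : G} (hc : Perm.sign (π c) = 1) {p₁ p₂ p₃ d : α}
    (hnd : [p₁, p₂, p₃, d].Nodup) (h₁ : p₁ ∈ H) (h₂ : p₂ ∈ H) (h₃ : p₃ ∈ H)
    (hd : d ∈ H) (hc₁ : π c p₁ = p₂) (hc₂ : π c p₂ = p₃)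
    (hc₃ : π c p₃ = p₁) (hcd : π c d = d) : ∃ u ∈ X, R c u ≠ u := by
  obtain ⟨y, hy⟩ := h.surj (swap p₁ p₂ * swap p₃ d)
  simp only [List.nodup_cons, List.mem_cons, List.not_mem_nil, or_false, not_or, List.nodup_nil,
    and_true, not_false_eq_true] at hnd
  obtain ⟨⟨h12, h13, h1d⟩, ⟨h23, h2d⟩, h3d⟩ := hnd
  have hye : Perm.sign (π y) = 1 := by
    rw [hy, Perm.sign_mul, Perm.sign_swap h12, Perm.sign_swap h3d]; rfl
  have hyH : ∀ a, π y a ≠ a → a ∈ H := by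
    rw [hy]
    exact fun a => mem_of_double_swap_ne h₁ h₂ h₃ hd
  refine hR.exists_apply_ne h hX hXH hc hye hyH (p₁ := p₁) (p₂ := p₃) (p₃ := p₂) (p₄ := d)
    (by simp [h13, h12, h1d, Ne.symm h23, h3d, h2d]) h₁ h₃ h₂ hd ?_
  have h5 : π (c * y * c⁻¹ * y⁻¹) = swap p₂ p₃ * swap p₁ d * (swap p₁ p₂ * swap p₃ d)⁻¹ := by
    have : π c * (swap p₁ p₂ * swap p₃ d) * (π c)⁻¹ =
      (π c * swap p₁ p₂ * (π c)⁻¹) * (π c * swap p₃ d * (π c)⁻¹) := by group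
    rw [map_mul, map_mul, map_mul, map_inv, map_inv, hy, this, ← swap_apply_apply,
      ← swap_apply_apply, hc₁, hc₂, hc₃, hcd]
  rw [h5, mul_inv_rev, swap_inv, swap_inv]
  ext a
  simp only [Perm.mul_apply, swap_apply_def]
  grind

end EvenRep

lemma add_sum_ne_zero_of_eigenvectors {V ι κ : Type*} [AddCommGroup V] [Module ℂ V]
    (T : ι → Module.End ℂ V) (χ : κ → ι → ℂ) (k₀ : κ) (s : Finset κ)
    (hs : ∀ k ∈ s, ∃ i, χ k i ≠ χ k₀ i) (x : κ → V) (hx : ∀ k i, T i (x k) = χ k i • x k)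
    (hx₀ : x k₀ ≠ 0) : x k₀ + ∑ k ∈ s, x k ≠ 0 := by
  classical
  induction s using Finset.induction_on generalizing x with
  | empty => simpa using hx₀
  | insert k s hk ih =>
    intro h0
    obtain ⟨i, hi⟩ := hs k (Finset.mem_insert_self k s)
    refine ih (fun k' hk' => hs k' (Finset.mem_insert_of_mem hk'))
      (fun k' => (χ k' i - χ k i) • x k')
      (fun k' i' => by rw [_root_.map_smul, hx, smul_comm])
      (smul_ne_zero (sub_ne_zero.mpr (Ne.symm hi)) hx₀) ?_
    have h1 := congrArg (fun v => T i v - χ k i • v) h0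
    simp only [map_add, map_sum, hx, smul_add, Finset.smul_sum, map_zero, smul_zero,
      sub_zero] at h1
    rw [Finset.sum_insert hk, Finset.sum_insert hk] at h1
    simp only [sub_smul, Finset.sum_sub_distrib]
    rw [← h1]
    abel

section Blocks

open Equiv

variable {l q : ℕ}

/-- The permutation translating the `i`-th block by `a i`. -/
def blockShift (a : ZMod l → ZMod q) : Perm (ZMod l × ZMod q) :=
  Equiv.prodCongrRight fun i => Equiv.addRight (a i)

/-- The permutation scaling the `i`-th block by `u i`. -/
def blockScale (u : ZMod l → (ZMod q)ˣ) : Perm (ZMod l × ZMod q) :=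
  Equiv.prodCongrRight fun i => MulAction.toPermHom (ZMod q)ˣ (ZMod q) (u i)

@[simp] lemma blockShift_apply (a : ZMod l → ZMod q) (x : ZMod l × ZMod q) :
    blockShift a x = (x.1, x.2 + a x.1) := rfl

@[simp] lemma blockScale_apply (u : ZMod l → (ZMod q)ˣ) (x : ZMod l × ZMod q) :
    blockScale u x = (x.1, u x.1 * x.2) := rfl

lemma blockShift_add (a b : ZMod l → ZMod q) :
    blockShift (a + b) = blockShift a * blockShift b := by
  ext x <;> simp [add_comm, add_left_comm]

lemma blockShift_zero : blockShift (0 : ZMod l → ZMod q) = 1 := by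
  ext x <;> simp

lemma blockShift_pow (a : ZMod l → ZMod q) (k : ℕ) : blockShift a ^ k = blockShift (k • a) := by
  induction k with
  | zero => rw [pow_zero, zero_smul, blockShift_zero]
  | succ k ih => rw [pow_succ, ih, succ_nsmul, blockShift_add]

lemma blockShift_pow_card (a : ZMod l → ZMod q) : blockShift a ^ q = 1 := by
  rw [blockShift_pow]
  have : q • a = 0 := by
    funext i
    simp
  rw [this, blockShift_zero]

lemma blockScale_mul_blockShift (u : ZMod l → (ZMod q)ˣ) (a : ZMod l → ZMod q) :
    blockScale u * blockShift a = blockShift (fun i => (u i : ZMod q) * a i) * blockScale u := by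
  ext x <;> simp [mul_add]

lemma sign_blockScale [NeZero l] [NeZero q] (u : ZMod l → (ZMod q)ˣ) (hu : IsSquare (∏ i, u i)) :
    Perm.sign (blockScale u) = 1 := by
  let f : (ZMod q)ˣ →* ℤˣ := Perm.sign.comp (MulAction.toPermHom (ZMod q)ˣ (ZMod q))
  have h1 : Perm.sign (blockScale u) = f (∏ i, u i) := by
    rw [blockScale, Perm.sign_prodCongrRight, map_prod]
    rfl
  obtain ⟨r, hr⟩ := hu
  rw [h1, hr, map_mul, Int.units_mul_self]

variable [NeZero l] [Fact q.Prime] {G V : Type*} [Group G] [AddCommGroup V] [Module ℂ V]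
  {π : G →* Perm (ZMod l × ZMod q)} {z : G} {R : G → Module.End ℂ V} {c : ZMod l → G}

lemma sign_blockShift (hq2 : Odd q) (a : ZMod l → ZMod q) : Perm.sign (blockShift a) = 1 :=
  Perm.sign_eq_one_of_odd_pow hq2 (blockShift_pow_card a)

/-- The weights of the commuting operators `R (c i)`. -/
def weights (R : G → Module.End ℂ V) (c : ZMod l → G) : Set (ZMod l → ZMod q) :=
  {w | ∃ v ≠ 0, ∀ i, R (c i) v = ZMod.stdAddChar (w i) • v}

lemma commute_blockShift_lift (h : SpinCover π z) (hq2 : Odd q)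
    (hc : ∀ i, π (c i) = blockShift (Pi.single i 1)) (i j : ZMod l) : Commute (c i) (c j) := by
  rcases eq_or_ne i j with rfl | hij
  · exact Commute.refl _
  · refine h.commute_of_even (by rw [hc, sign_blockShift hq2]) fun x hx => ?_
    rw [hc, blockShift_apply] at hx ⊢
    by_cases hj : x.1 = j
    · exfalso
      apply hx
      rw [hj, Pi.single_eq_of_ne (Ne.symm hij), add_zero, ← hj]
    · rw [Pi.single_eq_of_ne hj, add_zero]

lemma weights_extend (h : SpinCover π z) (hR : EvenRep π z R) (hq2 : Odd q)
    (hc : ∀ i, π (c i) = blockShift (Pi.single i 1)) (hcq : ∀ i, c i ^ q = 1)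
    {S : Finset (ZMod l)} {w : ZMod l → ZMod q} {v : V}
    (hv : ∀ i ∈ S, R (c i) v = ZMod.stdAddChar (w i) • v) {j : ZMod l} (hj : j ∉ S)
    {s : ZMod q} (hs : eigenProj q (R (c j)) s v ≠ 0) :
    ∃ v' ≠ 0, ∀ i ∈ insert j S,
      R (c i) v' = ZMod.stdAddChar (Function.update w j s i) • v' := by
  have he : ∀ i, Perm.sign (π (c i)) = 1 := fun i => by rw [hc, sign_blockShift hq2]
  refine ⟨_, hs, fun i hi => ?_⟩
  rcases Finset.mem_insert.mp hi with rfl | hi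
  · rw [Function.update_self]
    refine congrArg (fun f : Module.End ℂ V => f v) (mul_eigenProj ?_ s)
    rw [← hR.pow (he i), hcq, hR.one]
  · have hij : i ≠ j := fun e => hj (e ▸ hi)
    rw [Function.update_of_ne hij, ← _root_.map_smul, ← hv i hi]
    exact (congrArg (fun f : Module.End ℂ V => f v) (eigenProj_commute (hR.commute (he j) (he i)
      (commute_blockShift_lift h hq2 hc j i)) s).eq).symm

lemma exists_weight_ne_zero_off_zero [Nontrivial V] (h : SpinCover π z) (hR : EvenRep π z R)
    (hq2 : Odd q) (hc : ∀ i, π (c i) = blockShift (Pi.single i 1)) (hcq : ∀ i, c i ^ q = 1) :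
    ∃ w ∈ weights (q := q) R c, ∀ i, i ≠ 0 → w i ≠ 0 := by
  have he : ∀ i, Perm.sign (π (c i)) = 1 := fun i => by rw [hc, sign_blockShift hq2]
  have key : ∀ S : Finset (ZMod l), 0 ∉ S → ∃ w : ZMod l → ZMod q, (∀ i ∈ S, w i ≠ 0) ∧
      ∃ v : V, v ≠ 0 ∧ ∀ i ∈ S, R (c i) v = ZMod.stdAddChar (w i) • v := by
    intro S
    induction S using Finset.induction_on with
    | empty =>
      obtain ⟨v, hv⟩ := exists_ne (0 : V)
      exact fun _ => ⟨0, by simp, v, hv, by simp⟩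
    | insert j S hj ih =>
      intro h0
      have h0j : j ≠ 0 := fun e => h0 (e ▸ Finset.mem_insert_self j S)
      have h0S : 0 ∉ S := fun e => h0 (Finset.mem_insert_of_mem e)
      obtain ⟨w, hw, v, hv, hv'⟩ := ih h0S
      let X : Submodule ℂ V := ⨅ i ∈ S,
        LinearMap.ker (R (c i) - ZMod.stdAddChar (w i) • (1 : Module.End ℂ V))
      have hXm : ∀ u, u ∈ X ↔ ∀ i ∈ S, R (c i) u = ZMod.stdAddChar (w i) • u := by
        intro u
        simp [X, Submodule.mem_iInf, sub_eq_zero]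
      have hX : X ≠ ⊥ := fun e => hv ((Submodule.eq_bot_iff X).mp e v ((hXm v).mpr hv'))
      let H : Set (ZMod l × ZMod q) := {x | x.1 = 0 ∨ x.1 = j}
      have hXH : ∀ y, Perm.sign (π y) = 1 → (∀ a, π y a ≠ a → a ∈ H) → ∀ u ∈ X, R y u ∈ X := by
        intro y hy hyH u hu
        rw [hXm] at hu ⊢
        intro i hi
        have hcomm : Commute (c i) y := by
          refine h.commute_of_even hy fun x hx => ?_
          by_contra hne
          apply hx
          have hxi : x.1 ≠ i := by
            rcases hyH x hne with e | e
            · rw [e]; exact fun e' => h0S (e' ▸ hi)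
            · rw [e]; exact fun e' => hj (e' ▸ hi)
          rw [hc, blockShift_apply, Pi.single_eq_of_ne hxi, add_zero]
        rw [← _root_.map_smul, ← hu i hi]
        exact congrArg (fun f : Module.End ℂ V => f u) (hR.commute (he i) hy hcomm).eq
      have hne : ∃ u ∈ X, R (c j) u ≠ u := by
        have hfix : ∀ a : ZMod q, π (c j) (0, a) = (0, a) := fun a => by
          rw [hc, blockShift_apply, Pi.single_eq_of_ne (Ne.symm h0j), add_zero]
        have hmov : ∀ a : ZMod q, π (c j) (j, a) = (j, a + 1) := fun a => by
          rw [hc, blockShift_apply, Pi.single_eq_same]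
        have hn : ∀ k : ℕ, 0 < k → k < q → (k : ZMod q) ≠ 0 := fun k => natCast_ne_zero_of_lt
        have hq3 : q = 3 ∨ 5 ≤ q := by
          have := (Fact.out : q.Prime).two_le
          obtain ⟨k, hk⟩ := hq2
          omega
        rcases hq3 with hq3 | hq5
        · have h1 := hn 1 (by omega) (by omega)
          have h2 := hn 2 (by omega) (by omega)
          push_cast at h1 h2
          have h3 : (3 : ZMod q) = 0 := by
            exact_mod_cast (ZMod.natCast_eq_zero_iff 3 q).mpr (by rw [hq3])
          refine hR.exists_apply_ne_of_three h hX hXH (he j) (p₁ := (j, 0)) (p₂ := (j, 1))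
            (p₃ := (j, 2)) (d := (0, 0)) ?_ (Or.inr rfl) (Or.inr rfl) (Or.inr rfl) (Or.inl rfl)
            ?_ ?_ ?_ (hfix _)
          · have h21 : (1 : ZMod q) ≠ 2 := fun e => h1 (by linear_combination -e)
            simp [h0j, Ne.symm h1, Ne.symm h2, h21]
          · rw [hmov, zero_add]
          · rw [hmov, one_add_one_eq_two]
          · rw [hmov, two_add_one_eq_three, h3]
        · have h1 := hn 1 (by omega) (by omega)
          have h2 := hn 2 (by omega) (by omega)
          have h3 := hn 3 (by omega) (by omega)
          push_cast at h1 h2 h3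
          refine hR.exists_apply_ne_of_five h hX hXH (he j) (p₁ := (j, 0)) (p₂ := (j, 1))
            (p₃ := (j, 2)) (p₄ := (j, 3)) (d := (0, 0)) (e := (0, 1)) ?_ (Or.inr rfl) (Or.inr rfl)
            (Or.inr rfl) (Or.inr rfl) (Or.inl rfl) (Or.inl rfl) ?_ ?_ (hfix _) (hfix _)
          · have h21 : (1 : ZMod q) ≠ 2 := fun e => h1 (by linear_combination -e)
            have h31 : (1 : ZMod q) ≠ 3 := fun e => h2 (by linear_combination -e)
            have h32 : (2 : ZMod q) ≠ 3 := fun e => h1 (by linear_combination -e)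
            simp [h0j, Ne.symm h1, Ne.symm h2, Ne.symm h3, h21, h31, h32]
          · rw [hmov, zero_add]
          · rw [hmov, two_add_one_eq_three]
      obtain ⟨u, hu, hune⟩ := hne
      obtain ⟨s, hs, hs'⟩ := exists_eigenProj_ne_zero_of_ne (N := q)
        (by rw [← hR.pow (he j), hcq, hR.one]) hune
      obtain ⟨v', hv0, hv1⟩ := weights_extend h hR hq2 hc hcq ((hXm u).mp hu) hj hs'
      refine ⟨Function.update w j s, fun i hi => ?_, v', hv0, hv1⟩
      rcases Finset.mem_insert.mp hi with rfl | hi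
      · rwa [Function.update_self]
      · have hij : i ≠ j := fun e => hj (e ▸ hi)
        rw [Function.update_of_ne hij]
        exact hw i hi
  obtain ⟨w, hw, v, hv, hv'⟩ := key (Finset.univ.erase 0) (by simp)
  obtain ⟨s, hs⟩ := exists_eigenProj_ne_zero (N := q) hv (R (c 0))
  obtain ⟨v', hv0, hv1⟩ := weights_extend h hR hq2 hc hcq hv' (by simp) hs
  refine ⟨_, ⟨v', hv0, fun i => hv1 i (by simp)⟩, fun i hi => ?_⟩
  rw [Function.update_of_ne hi]
  exact hw i (by simp [hi])

lemma weights_scale [Nontrivial V] (h : SpinCover π z) (hR : EvenRep π z R)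
    (hq2 : Odd q) (hc : ∀ i, π (c i) = blockShift (Pi.single i 1)) (hcq : ∀ i, c i ^ q = 1)
    {w : ZMod l → ZMod q} (hw : w ∈ weights R c) (u : ZMod l → (ZMod q)ˣ)
    (hu : IsSquare (∏ i, u i)) : (fun i => (u i : ZMod q) * w i) ∈ weights R c := by
  have he : ∀ i, Perm.sign (π (c i)) = 1 := fun i => by rw [hc, sign_blockShift hq2]
  obtain ⟨v, hv, hvw⟩ := hw
  obtain ⟨y, hy⟩ := h.surj (blockScale u)
  have hye : Perm.sign (π y) = 1 := by rw [hy, sign_blockScale u hu]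
  have hconj : ∀ i, y * c i = c i ^ (u i : ZMod q).val * y := by
    intro i
    rw [← mul_inv_eq_iff_eq_mul]
    refine h.eq_of_pow_eq_one hR.z_ne_one hq2 (by rw [conj_pow, hcq, mul_one, mul_inv_cancel])
      (by rw [← pow_mul, mul_comm, pow_mul, hcq, one_pow]) ?_
    rw [map_mul, map_inv, mul_inv_eq_iff_eq_mul, map_mul, map_pow, hy, hc,
      blockScale_mul_blockShift, blockShift_pow]
    congr 2
    funext j
    by_cases hj : j = i
    · subst hj
      simp
    · simp [hj]
  refine ⟨R y⁻¹ v, hR.apply_ne_zero (EvenRep.sign_inv hye) hv, fun i => ?_⟩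
  have h1 : c i * y⁻¹ = y⁻¹ * c i ^ (u i : ZMod q).val := by
    rw [mul_inv_eq_iff_eq_mul, mul_assoc, ← hconj, inv_mul_cancel_left]
  have h2 : ∀ k : ℕ, R (c i ^ k) v = ZMod.stdAddChar (k • w i) • v := by
    intro k
    induction k with
    | zero => rw [pow_zero, hR.one, zero_smul, AddChar.map_zero_eq_one, one_smul]; rfl
    | succ k ih =>
      rw [pow_succ', hR.mul _ _ (he i) (by rw [map_pow, map_pow, he, one_pow]),
        Module.End.mul_apply, ih, _root_.map_smul, hvw, smul_smul, ← AddChar.map_add_eq_mul,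
        succ_nsmul]
  rw [← Module.End.mul_apply, ← hR.mul _ _ (he i) (EvenRep.sign_inv hye), h1,
    hR.mul _ _ (EvenRep.sign_inv hye) (by rw [map_pow, map_pow, he, one_pow]),
    Module.End.mul_apply, h2, _root_.map_smul]
  simp

lemma exists_prod_blockShift_lift (h : SpinCover π z) (hR : EvenRep π z R)
    (hq2 : Odd q) (hc : ∀ i, π (c i) = blockShift (Pi.single i 1)) (hcq : ∀ i, c i ^ q = 1)
    (S : Finset (ZMod l)) : ∃ D, π D = blockShift (∑ j ∈ S, Pi.single j 1) ∧ D ^ q = 1 ∧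
      (∀ j, Commute D (c j)) ∧ ∀ (v : V) (w : ZMod l → ZMod q),
        (∀ i, R (c i) v = ZMod.stdAddChar (w i) • v) →
          R D v = ZMod.stdAddChar (∑ j ∈ S, w j) • v := by
  have he : ∀ i, Perm.sign (π (c i)) = 1 := fun i => by rw [hc, sign_blockShift hq2]
  induction S using Finset.induction_on with
  | empty =>
    refine ⟨1, by simp [blockShift_zero], one_pow q, fun j => Commute.one_left _, fun v w _ => ?_⟩
    rw [hR.one]
    simp
  | insert j S hj ih =>
    obtain ⟨D, hD, hDq, hDc, hDv⟩ := ih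
    refine ⟨c j * D, ?_, ?_, fun i => (commute_blockShift_lift h hq2 hc j i).mul_left (hDc i),
      fun v w hv => ?_⟩
    · rw [map_mul, hD, hc, ← blockShift_add, Finset.sum_insert hj]
    · rw [(hDc j).symm.mul_pow, hDq, hcq, mul_one]
    · rw [hR.mul _ _ (he j) (by rw [hD, sign_blockShift hq2]), Module.End.mul_apply, hDv v w hv,
        _root_.map_smul, hv, smul_smul, ← AddChar.map_add_eq_mul, Finset.sum_insert hj, add_comm]

/-- An element of odd order `l * q` over an `l * q`-cycle has every `l * q`-th root of unity as an
eigenvalue. -/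
lemma exists_eigenvector_of_blocks [Nontrivial V] (h : SpinCover π z) (hR : EvenRep π z R)
    (hq2 : Odd q) (hl2 : Odd l) (hql : (5 ≤ q ∧ 3 ≤ l) ∨ (q = 3 ∧ 7 ≤ l)) {g : G}
    (hg : g ^ (l * q) = 1) (hg1 : ∀ x, (π g x).1 = x.1 + 1) (hgl : π g ^ l = blockShift 1)
    {μ : ℂ} (hμ : μ ^ (l * q) = 1) : ∃ u ≠ 0, R g u = μ • u := by
  have hge : Perm.sign (π g) = 1 :=
    Perm.sign_eq_one_of_odd_pow (hl2.mul hq2) (by rw [← map_pow, hg, map_one])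
  choose c hc hcq using fun i : ZMod l =>
    h.exists_lift_pow_eq_one hq2 (blockShift_pow_card (Pi.single i (1 : ZMod q)))
  have he : ∀ i, Perm.sign (π (c i)) = 1 := fun i => by rw [hc, sign_blockShift hq2]
  have hgc : ∀ i, g * c i = c (i + 1) * g := by
    intro i
    rw [← mul_inv_eq_iff_eq_mul]
    refine h.eq_of_pow_eq_one hR.z_ne_one hq2 (by rw [conj_pow, hcq, mul_one, mul_inv_cancel])
      (hcq _) ?_
    rw [map_mul, map_inv, mul_inv_eq_iff_eq_mul, map_mul, hc, hc]
    have hcomm : π g * blockShift 1 = blockShift 1 * π g := by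
      rw [← hgl]
      exact ((Commute.refl (π g)).pow_right l).eq
    ext1 x
    have h1 := congrArg (fun f : Perm _ => f x) hcomm
    simp only [Perm.mul_apply, blockShift_apply, Pi.one_apply, hg1] at h1 ⊢
    by_cases hx : x.1 = i
    · rw [hx, Pi.single_eq_same, Pi.single_eq_same, ← hx, h1]
    · rw [Pi.single_eq_of_ne hx, Pi.single_eq_of_ne (fun e => hx (add_right_cancel e)), add_zero,
        add_zero, ← hg1]
  obtain ⟨D, hD, hDq, -, hDv⟩ := exists_prod_blockShift_lift h hR hq2 hc hcq Finset.univ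
  have hDg : D = g ^ l := by
    refine h.eq_of_pow_eq_one hR.z_ne_one hq2 hDq (by rw [← pow_mul, hg]) ?_
    rw [hD, map_pow, hgl]
    exact congrArg blockShift (Finset.univ_sum_single (1 : ZMod l → ZMod q))
  obtain ⟨s, hs⟩ : ∃ s : ZMod q, ZMod.stdAddChar s = μ ^ l := by
    rw [pow_mul] at hμ
    exact exists_stdAddChar_eq hμ
  obtain ⟨w₀, hw₀, hw₀'⟩ := exists_weight_ne_zero_off_zero h hR hq2 hc hcq
  obtain ⟨w, ⟨v, hv, hvw⟩, hws, hwa⟩ := exists_aperiodic_weight hql (weights (q := q) R c)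
    (fun w hw u hu => weights_scale h hR hq2 hc hcq hw u hu) hw₀ hw₀' s
  have hμ0 : μ ≠ 0 := by
    rintro rfl
    rw [zero_pow (mul_ne_zero (NeZero.ne l) (NeZero.ne q))] at hμ
    exact zero_ne_one hμ
  have hgv : R g ^ l • v = μ ^ l • v := by
    rw [← hR.pow hge, ← hDg, ← hs, ← hws]
    exact hDv v w hvw
  have hck : ∀ (k : ℕ) i, R (c i) ((R g ^ k) v) = ZMod.stdAddChar (w (i - k)) • (R g ^ k) v := by
    intro k
    induction k with
    | zero => intro i; simpa using hvw i
    | succ k ih =>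
      intro i
      have h1 : R (c i) * R g = R g * R (c (i - 1)) := by
        rw [← hR.mul _ _ (he _) hge, ← hR.mul _ _ hge (he _), hgc, sub_add_cancel]
      rw [pow_succ', Module.End.mul_apply, ← Module.End.mul_apply, h1, Module.End.mul_apply, ih,
        _root_.map_smul]
      congr 3
      push_cast
      ring
  let x : ℕ → V := fun k => μ⁻¹ ^ k • (R g ^ k) v
  refine ⟨∑ k ∈ Finset.range l, x k, ?_, ?_⟩
  · rw [← Finset.add_sum_erase _ _ (Finset.mem_range.mpr (NeZero.pos l))]
    refine add_sum_ne_zero_of_eigenvectors (fun i => R (c i))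
      (fun (k : ℕ) i => ZMod.stdAddChar (w (i - k))) 0 _ (fun k hk => ?_) x (fun k i => ?_) ?_
    · by_contra! hne
      rw [Finset.mem_erase, Finset.mem_range] at hk
      refine natCast_ne_zero_of_lt (Nat.pos_of_ne_zero hk.1) hk.2
        (neg_eq_zero.mp (hwa _ fun i => ?_))
      have := ZMod.injective_stdAddChar (hne i)
      rwa [Nat.cast_zero, sub_zero, sub_eq_add_neg] at this
    · rw [_root_.map_smul, hck, smul_comm]
    · simpa [x] using hv
  · have h1 : R g (∑ k ∈ Finset.range l, x k) = μ • ∑ k ∈ Finset.range l, x (k + 1) := by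
      rw [map_sum, Finset.smul_sum]
      refine Finset.sum_congr rfl fun k _ => ?_
      simp only [x]
      rw [_root_.map_smul, smul_smul, pow_succ', pow_succ', ← mul_assoc, mul_inv_cancel₀ hμ0,
        one_mul, Module.End.mul_apply]
    have h2 : x l = x 0 := by
      simp only [x]
      rw [show (R g ^ l) v = μ ^ l • v from hgv, smul_smul, ← mul_pow, inv_mul_cancel₀ hμ0]
      simp
    have h3 := (Finset.sum_range_succ x l).symm.trans (Finset.sum_range_succ' x l)
    rw [h2] at h3
    rw [h1, ← add_right_cancel h3]

end Blocks

section Traces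

open Equiv Module

variable {G α V : Type*} [Group G] [DecidableEq α] [Fintype α] [AddCommGroup V] [Module ℂ V]
  {π : G →* Perm α} {z : G} {R : G → Module.End ℂ V}

/-- The squared absolute value of the character of `R`. -/
noncomputable def charSq (R : G → Module.End ℂ V) (x : G) : ℝ :=
  Complex.normSq (LinearMap.trace ℂ V (R x))

omit [Group G] in
lemma charSq_nonneg (R : G → Module.End ℂ V) (x : G) : 0 ≤ charSq R x := Complex.normSq_nonneg _

namespace EvenRep

lemma trace_conj (hR : EvenRep π z R) {x y : G} (hx : Perm.sign (π x) = 1)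
    (hy : Perm.sign (π y) = 1) :
    LinearMap.trace ℂ V (R (y * x * y⁻¹)) = LinearMap.trace ℂ V (R x) := by
  rw [hR.mul _ _ (sign_mul hy hx) (sign_inv hy), LinearMap.trace_mul_comm,
    ← hR.mul _ _ (sign_inv hy) (sign_mul hy hx), inv_mul_cancel_left]

lemma charSq_conj (hR : EvenRep π z R) {x y : G} (hx : Perm.sign (π x) = 1)
    (hy : Perm.sign (π y) = 1) : charSq R (y * x * y⁻¹) = charSq R x := by
  rw [charSq, charSq, hR.trace_conj hx hy]

lemma charSq_z_mul (hR : EvenRep π z R) (h : SpinCover π z) {x : G} (hx : Perm.sign (π x) = 1) :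
    charSq R (z * x) = charSq R x := by
  rw [charSq, charSq, hR.map_z_mul h hx, map_neg, Complex.normSq_neg]

lemma sum_charSq_odd_order_le [Fintype G] [DecidableEq G] (hR : EvenRep π z R) (h : SpinCover π z) (hz : z ≠ 1)
    {p : ℕ} (hp : Odd p) : 2 * ∑ x : G with Perm.sign (π x) = 1 ∧ x ^ p = 1, charSq R x ≤
      ∑ x : G with Perm.sign (π x) = 1, charSq R x := by
  classical
  let S : Finset G := {x : G | Perm.sign (π x) = 1 ∧ x ^ p = 1}
  have hzp : z ^ p = z := by
    obtain ⟨k, rfl⟩ := hp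
    rw [pow_succ, pow_mul, pow_two, h.sq, one_pow, one_mul]
  have h1 : ∑ x ∈ S.image (z * ·), charSq R x = ∑ x ∈ S, charSq R x := by
    rw [Finset.sum_image (fun a _ b _ e => mul_left_cancel e)]
    refine Finset.sum_congr rfl fun x hx => hR.charSq_z_mul h ?_
    exact (Finset.mem_filter.mp hx).2.1
  have hdisj : Disjoint S (S.image (z * ·)) := by
    rw [Finset.disjoint_left]
    intro x hx hx'
    obtain ⟨y, hy, rfl⟩ := Finset.mem_image.mp hx'
    have hx1 := (Finset.mem_filter.mp hx).2.2
    have hy1 := (Finset.mem_filter.mp hy).2.2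
    have hc : Commute z y := h.central y
    rw [hc.mul_pow, hy1, hzp, mul_one] at hx1
    exact hz hx1
  rw [two_mul]
  nth_rewrite 2 [← h1]
  rw [← Finset.sum_union hdisj]
  refine Finset.sum_le_sum_of_subset_of_nonneg (fun x hx => ?_) fun x _ _ => charSq_nonneg R x
  rw [Finset.mem_filter]
  refine ⟨Finset.mem_univ _, ?_⟩
  rcases Finset.mem_union.mp hx with hx | hx
  · exact (Finset.mem_filter.mp hx).2.1
  · obtain ⟨y, hy, rfl⟩ := Finset.mem_image.mp hx
    rw [map_mul, h.map_z, one_mul]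
    exact (Finset.mem_filter.mp hy).2.1

end EvenRep

lemma card_eq_two_mul_card_even [Fintype G] {t : G}
    (ht : Perm.sign (π t) = -1) :
    Fintype.card G = 2 * Finset.card {x : G | Perm.sign (π x) = 1} := by
  classical
  have h1 : Finset.card {x : G | ¬ Perm.sign (π x) = 1} =
      Finset.card {x : G | Perm.sign (π x) = 1} := by
    refine Finset.card_bij' (fun x _ => t⁻¹ * x) (fun x _ => t * x) ?_ ?_ (by simp) (by simp)
    · intro x hx
      simp only [Finset.mem_filter, Finset.mem_univ, true_and] at hx ⊢
      have := (Int.units_eq_one_or (Perm.sign (π x))).resolve_left hx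
      simp [ht, this]
    · intro x hx
      simp only [Finset.mem_filter, Finset.mem_univ, true_and] at hx ⊢
      simp [ht, hx]
  rw [← Finset.card_univ, ← Finset.card_filter_add_card_filter_not (s := Finset.univ)
    (fun x : G => Perm.sign (π x) = 1), h1, two_mul]

end Traces

section PrimeCycle

open Equiv Module

variable {p : ℕ} [Fact p.Prime] {G V : Type*} [Group G] [AddCommGroup V] [Module ℂ V]
  {π : G →* Perm (ZMod p)} {z g : G} {R : G → Module.End ℂ V}

/-- Multiplication by a unit of `ZMod p`, as a permutation. -/
def unitPerm (p : ℕ) : (ZMod p)ˣ →* Perm (ZMod p) := MulAction.toPermHom (ZMod p)ˣ (ZMod p)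

@[simp] lemma unitPerm_apply (u : (ZMod p)ˣ) (x : ZMod p) : unitPerm p u x = u * x := rfl

lemma exists_sign_unitPerm_eq_neg_one (hp : Odd p) :
    ∃ r : (ZMod p)ˣ, Perm.sign (unitPerm p r) = -1 := by
  obtain ⟨r, hr⟩ := IsCyclic.exists_generator (α := (ZMod p)ˣ)
  have hp3 : 3 ≤ p := by
    have := (Fact.out : p.Prime).two_le
    obtain ⟨k, hk⟩ := hp
    omega
  have hr1 : r ≠ 1 := by
    rintro rfl
    have h1 := hr (-1)
    simp only [Subgroup.zpowers_one_eq_bot, Subgroup.mem_bot] at h1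
    have h2 := congrArg (Units.val) h1
    simp only [Units.val_neg, Units.val_one] at h2
    have : (2 : ZMod p) ≠ 0 := two_ne_zero_zmod hp3
    exact this (by linear_combination -h2)
  have hmem : ∀ x, unitPerm p r x ≠ x ↔ x ≠ 0 := by
    intro x
    rw [unitPerm_apply, not_iff_not]
    refine ⟨fun hx => ?_, fun hx => by rw [hx, mul_zero]⟩
    by_contra hx0
    exact hr1 (Units.ext (mul_right_cancel₀ hx0 (hx.trans (one_mul x).symm)))
  refine ⟨r, ?_⟩
  have hcyc : (unitPerm p r).IsCycle := by
    refine ⟨1, (hmem 1).mpr one_ne_zero, fun y hy => ?_⟩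
    obtain ⟨k, hk⟩ := hr (Units.mk0 y ((hmem y).mp hy))
    refine ⟨k, ?_⟩
    rw [← map_zpow, unitPerm_apply, mul_one]
    exact congrArg Units.val hk
  have hsupp : (unitPerm p r).support = Finset.univ.erase 0 := by
    ext x
    simp [hmem, -unitPerm_apply]
  rw [hcyc.sign, hsupp, Finset.card_erase_of_mem (Finset.mem_univ _), Finset.card_univ, ZMod.card]
  obtain ⟨k, rfl⟩ := hp
  simp

/-- Conjugates of powers of a lift of the standard `p`-cycle. -/
lemma conj_eq_pow_of_unitPerm (h : SpinCover π z) (hz : z ≠ 1) (hp : Odd p) (hg : g ^ p = 1)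
    (hπg : π g = Equiv.addRight 1) {r : (ZMod p)ˣ} {y : G} (hy : π y = unitPerm p r) (j : ZMod p) :
    y * g ^ j.val * y⁻¹ = g ^ (r * j).val := by
  have hpow : ∀ k : ℕ, ∀ x, (π g ^ k) x = x + k := by
    intro k
    induction k with
    | zero => simp
    | succ k ih => intro x; rw [pow_succ', Perm.mul_apply, ih, hπg]; simp [add_assoc]
  refine h.eq_of_pow_eq_one hz hp ?_ ?_ ?_
  · rw [conj_pow, ← pow_mul, mul_comm, pow_mul, hg, one_pow, mul_one, mul_inv_cancel]
  · rw [← pow_mul, mul_comm, pow_mul, hg, one_pow]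
  · rw [map_mul, map_inv, mul_inv_eq_iff_eq_mul, map_mul, map_pow, map_pow, hy]
    ext1 x
    rw [Perm.mul_apply, Perm.mul_apply, hpow, hpow]
    simp [mul_add]

lemma card_conj_fiber_le [Fintype G] [DecidableEq G] (h : SpinCover π z)
    (hπg : π g = Equiv.addRight 1) (j : (ZMod p)ˣ) (x : G) :
    Finset.card {y : G | y * g ^ (j : ZMod p).val * y⁻¹ = x} ≤ 2 * p := by
  have hpow : ∀ k : ℕ, ∀ x, (π g ^ k) x = x + k := by
    intro k
    induction k with
    | zero => simp
    | succ k ih => intro x; rw [pow_succ', Perm.mul_apply, ih, hπg]; simp [add_assoc]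
  let S : Finset G := {y : G | y * g ^ (j : ZMod p).val * y⁻¹ = x}
  have h1 : S.card ≤ 2 * (S.image fun y => π y 0).card := by
    refine Finset.card_le_mul_card_image S 2 fun a ha => ?_
    obtain ⟨y, hy, hya⟩ := Finset.mem_image.mp ha
    refine (Finset.card_le_card (t := {y, z * y}) fun w hw => ?_).trans Finset.card_le_two
    rw [Finset.mem_filter] at hw
    have hy1 : y * g ^ (j : ZMod p).val * y⁻¹ = x := (Finset.mem_filter.mp hy).2
    have hw1 : w * g ^ (j : ZMod p).val * w⁻¹ = x := (Finset.mem_filter.mp hw.1).2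
    have hact : ∀ y, y * g ^ (j : ZMod p).val * y⁻¹ = x →
        ∀ k : ℕ, π y (k * j) = (π x ^ k) (π y 0) := by
      intro y hy k
      rw [mul_inv_eq_iff_eq_mul] at hy
      induction k with
      | zero => simp
      | succ k ih =>
        rw [pow_succ', Perm.mul_apply, ← ih, ← Perm.mul_apply, ← map_mul π x, ← hy, map_mul π y,
          Perm.mul_apply, map_pow, hpow]
        simp [add_mul]
    rw [Finset.mem_insert, Finset.mem_singleton]
    refine h.eq_or_of_map_eq (Equiv.ext fun a => ?_)
    have h2 : a = ((a * (j⁻¹ : (ZMod p)ˣ) : ZMod p).val : ZMod p) * j := by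
      rw [ZMod.natCast_zmod_val, mul_assoc, Units.inv_mul, mul_one]
    rw [h2, hact w hw1, hact y hy1, hw.2, hya]
  refine h1.trans (Nat.mul_le_mul_left 2 ?_)
  exact (Finset.card_le_univ _).trans (ZMod.card p).le

lemma sum_charSq_conj (h : SpinCover π z) (hR : EvenRep π z R) (hz : z ≠ 1) (hp : Odd p)
    (hg : g ^ p = 1) (hπg : π g = Equiv.addRight 1) (y : G) :
    ∑ j : (ZMod p)ˣ, charSq R (y * g ^ (j : ZMod p).val * y⁻¹) =
      ∑ j : (ZMod p)ˣ, charSq R (g ^ (j : ZMod p).val) := by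
  have hge : ∀ k : ℕ, Perm.sign (π (g ^ k)) = 1 := fun k => by
    rw [map_pow, map_pow, Perm.sign_eq_one_of_odd_pow hp (by rw [← map_pow, hg, map_one]), one_pow]
  rcases Int.units_eq_one_or (Perm.sign (π y)) with hy | hy
  · exact Finset.sum_congr rfl fun j _ => hR.charSq_conj (hge _) hy
  · obtain ⟨r, hr⟩ := exists_sign_unitPerm_eq_neg_one hp
    obtain ⟨t, ht⟩ := h.surj (unitPerm p r)
    have hyt : Perm.sign (π (y * t⁻¹)) = 1 := by simp [hy, ht, hr]
    have h1 : ∀ j : (ZMod p)ˣ, charSq R (y * g ^ (j : ZMod p).val * y⁻¹) =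
        charSq R (g ^ ((r * j : (ZMod p)ˣ) : ZMod p).val) := by
      intro j
      rw [← hR.charSq_conj (hge _) hyt, Units.val_mul,
        ← conj_eq_pow_of_unitPerm h hz hp hg hπg ht]
      congr 1
      group
    simp only [h1]
    exact Fintype.sum_equiv (Equiv.mulLeft r) _ _ fun j => rfl

/-- An upper bound for the mean square of the character on the nontrivial powers of a lift of
a `p`-cycle, coming from the orthogonality relations. -/
lemma two_mul_sum_charSq_le [Fintype G] (h : SpinCover π z) (hR : EvenRep π z R) (hz : z ≠ 1)
    (hp : Odd p) (hg : g ^ p = 1) (hπg : π g = Equiv.addRight 1)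
    (hchar : ∑ x : G with Perm.sign (π x) = 1, charSq R x =
      Finset.card {x : G | Perm.sign (π x) = 1}) :
    2 * ∑ j : (ZMod p)ˣ, charSq R (g ^ (j : ZMod p).val) ≤ p * (p - 1 : ℕ) := by
  classical
  have hge : ∀ k : ℕ, Perm.sign (π (g ^ k)) = 1 := fun k => by
    rw [map_pow, map_pow, Perm.sign_eq_one_of_odd_pow hp (by rw [← map_pow, hg, map_one]), one_pow]
  set Φ := ∑ j : (ZMod p)ˣ, charSq R (g ^ (j : ZMod p).val) with hΦ
  let S : Finset G := {x : G | Perm.sign (π x) = 1 ∧ x ^ p = 1}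
  have h1 : Fintype.card G * Φ ≤ (p - 1 : ℕ) * (2 * p * ∑ x ∈ S, charSq R x) := by
    have h2 : Fintype.card G * Φ = ∑ j : (ZMod p)ˣ, ∑ y : G,
        charSq R (y * g ^ (j : ZMod p).val * y⁻¹) := by
      rw [Finset.sum_comm, Finset.sum_congr rfl
        (fun y _ => sum_charSq_conj h hR hz hp hg hπg y), Finset.sum_const, Finset.card_univ,
        nsmul_eq_mul]
    have h3 : (p - 1 : ℕ) * (2 * p * ∑ x ∈ S, charSq R x) =
        ∑ j : (ZMod p)ˣ, 2 * p * ∑ x ∈ S, charSq R x := by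
      rw [Finset.sum_const, Finset.card_univ, ZMod.card_units, nsmul_eq_mul]
    rw [h2, h3]
    refine Finset.sum_le_sum fun j _ => ?_
    have h4 : ∀ y ∈ (Finset.univ : Finset G), y * g ^ (j : ZMod p).val * y⁻¹ ∈ S := by
      intro y _
      refine Finset.mem_filter.mpr ⟨Finset.mem_univ _, ?_, ?_⟩
      · have := hge (j : ZMod p).val
        rw [map_mul, map_mul π y, map_inv, Perm.sign_mul, Perm.sign_mul, Perm.sign_inv, this,
          mul_one, Int.units_mul_self]
      · rw [conj_pow, ← pow_mul, mul_comm, pow_mul, hg, one_pow, mul_one, mul_inv_cancel]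
    rw [← Finset.sum_fiberwise_of_maps_to h4, Finset.mul_sum]
    refine Finset.sum_le_sum fun x _ => ?_
    rw [Finset.sum_congr rfl (fun y hy => congrArg (charSq R) (Finset.mem_filter.mp hy).2),
      Finset.sum_const, nsmul_eq_mul]
    refine mul_le_mul_of_nonneg_right ?_ (charSq_nonneg R x)
    exact_mod_cast card_conj_fiber_le h hπg j x
  have h5 := hR.sum_charSq_odd_order_le h hz hp
  obtain ⟨r, hr⟩ := exists_sign_unitPerm_eq_neg_one hp
  obtain ⟨t, ht⟩ := h.surj (unitPerm p r)
  have h6 : (Fintype.card G : ℝ) = 2 * (Finset.card {x : G | Perm.sign (π x) = 1} : ℕ) := by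
    exact_mod_cast card_eq_two_mul_card_even (π := π) (t := t) (by rw [ht, hr])
  have h7 : (0 : ℝ) < (Finset.card {x : G | Perm.sign (π x) = 1} : ℕ) := by
    exact_mod_cast Finset.card_pos.mpr ⟨1, by simp⟩
  rw [hchar] at h5
  rw [h6] at h1
  have h8 := mul_le_mul_of_nonneg_left h5 (show 0 ≤ ((p - 1 : ℕ) : ℝ) * p by positivity)
  refine le_of_mul_le_mul_right ?_ h7
  linarith

end PrimeCycle

section PrimeMult

open Equiv Module ZMod

variable {V : Type*} [AddCommGroup V] [Module ℂ V] [FiniteDimensional ℂ V]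

lemma sum_eigenMult {N : ℕ} [NeZero N] {X : End ℂ V} (hX : X ^ N = 1) :
    ∑ s, eigenMult N X s = finrank ℂ V := by
  have h1 := trace_pow_eq_sum hX 0
  simp only [ZMod.val_zero, pow_zero, LinearMap.trace_one, mul_zero, AddChar.map_zero_eq_one,
    mul_one] at h1
  exact_mod_cast h1.symm

lemma sum_normSq_trace_pow {N : ℕ} [NeZero N] {X : End ℂ V} (hX : X ^ N = 1) :
    ∑ j : ZMod N, Complex.normSq (LinearMap.trace ℂ V (X ^ j.val)) =
      N * ∑ s, (eigenMult N X s : ℝ) ^ 2 := by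
  have h1 : ∀ j : ZMod N, (Complex.normSq (LinearMap.trace ℂ V (X ^ j.val)) : ℂ) =
      ∑ s, ∑ t, (eigenMult N X s * eigenMult N X t : ℂ) * stdAddChar (j * (s - t)) := by
    intro j
    rw [← Complex.mul_conj, trace_pow_eq_sum hX, map_sum, Finset.sum_mul_sum]
    refine Finset.sum_congr rfl fun s _ => Finset.sum_congr rfl fun t _ => ?_
    rw [map_mul (starRingEnd ℂ), Complex.conj_natCast, ← AddChar.map_neg_eq_conj, mul_mul_mul_comm,
      ← AddChar.map_add_eq_mul]
    congr 2
    ring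
  apply Complex.ofReal_injective
  push_cast
  simp only [h1]
  rw [Finset.sum_comm, Finset.mul_sum]
  refine Finset.sum_congr rfl fun s _ => ?_
  rw [Finset.sum_comm]
  simp only [← Finset.mul_sum, AddChar.sum_mulShift _ (isPrimitive_stdAddChar N), sub_eq_zero]
  simp [ZMod.card]
  ring

variable {p : ℕ} [Fact p.Prime] {G : Type*} [Group G]
  {π : G →* Perm (ZMod p)} {z g : G} {R : G → Module.End ℂ V}

lemma eigenMult_unit_mul (h : SpinCover π z) (hR : EvenRep π z R)
    (hz : z ≠ 1) (hp : Odd p)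
    (hg : g ^ p = 1) (hπg : π g = Equiv.addRight 1) {r : (ZMod p)ˣ}
    (hr : Perm.sign (unitPerm p r) = 1) (s : ZMod p) :
    eigenMult p (R g) (r * s) = eigenMult p (R g) s := by
  have hge : Perm.sign (π g) = 1 :=
    Perm.sign_eq_one_of_odd_pow hp (by rw [← map_pow, hg, map_one])
  have hX : R g ^ p = 1 := by rw [← hR.pow hge, hg, hR.one]
  obtain ⟨y, hy⟩ := h.surj (unitPerm p r)
  have h1 : ∀ j : ZMod p, LinearMap.trace ℂ V (R g ^ (r * j).val) =
      LinearMap.trace ℂ V (R g ^ j.val) := by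
    intro j
    rw [← hR.pow hge, ← hR.pow hge, ← conj_eq_pow_of_unitPerm h hz hp hg hπg hy]
    exact hR.trace_conj (by rw [map_pow, map_pow, hge, one_pow]) (by rw [hy, hr])
  have h2 : (eigenMult p (R g) (r * s) : ℂ) = eigenMult p (R g) s := by
    rw [eigenMult_eq hX, eigenMult_eq hX]
    congr 1
    refine Fintype.sum_equiv (unitPerm p r) _ _ fun j => ?_
    rw [unitPerm_apply, h1]
    congr 2
    ring
  exact_mod_cast h2

/-- The eigenvalue multiplicities of a lift of a `p`-cycle take only two values away from `0`. -/
lemma exists_eigenMult_values (h : SpinCover π z) (hR : EvenRep π z R) (hz : z ≠ 1)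
    (hp : Odd p) (hg : g ^ p = 1) (hπg : π g = Equiv.addRight 1) :
    ∃ a b : ℕ, (∀ s, s ≠ 0 → eigenMult p (R g) s = a ∨ eigenMult p (R g) s = b) ∧
      ∀ F : ℕ → ℕ, 2 * ∑ s, F (eigenMult p (R g) s) =
        2 * F (eigenMult p (R g) 0) + (p - 1) * (F a + F b) := by
  obtain ⟨r, hr⟩ := exists_sign_unitPerm_eq_neg_one hp
  set m := eigenMult p (R g)
  have hm : ∀ u : (ZMod p)ˣ, Perm.sign (unitPerm p u) = 1 → ∀ s, m (u * s) = m s :=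
    fun u hu s => eigenMult_unit_mul h hR hz hp hg hπg hu s
  have hval : ∀ s : (ZMod p)ˣ, (m s = m 1 ∧ m (r * s) = m r) ∨ (m s = m r ∧ m (r * s) = m 1) := by
    intro s
    rcases Int.units_eq_one_or (Perm.sign (unitPerm p s)) with hs | hs
    · refine Or.inl ⟨?_, ?_⟩
      · rw [← hm s hs 1, mul_one]
      · rw [mul_comm, hm s hs]
    · refine Or.inr ⟨?_, ?_⟩
      · rw [← hm (s * r⁻¹) (by rw [map_mul, map_inv, Perm.sign_mul, Perm.sign_inv, hs, hr]; rfl) r,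
          Units.val_mul, mul_assoc, Units.inv_mul, mul_one]
      · rw [← hm (r * s) (by rw [map_mul, Perm.sign_mul, hs, hr]; rfl) 1, mul_one, Units.val_mul]
  refine ⟨m 1, m r, fun s hs => ?_, fun F => ?_⟩
  · exact (hval (Units.mk0 s hs)).imp And.left And.left
  · have h1 : ∑ s, F (m s) = F (m 0) + ∑ s : (ZMod p)ˣ, F (m s) := by
      rw [Fintype.sum_eq_add_sum_subtype_ne _ (0 : ZMod p)]
      congr 1
      exact Fintype.sum_equiv unitsEquivNeZero.symm _ _ fun x => rfl
    have h2 : ∑ s : (ZMod p)ˣ, F (m (r * s)) = ∑ s : (ZMod p)ˣ, F (m s) :=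
      Fintype.sum_equiv (Equiv.mulLeft r) _ _ fun j => rfl
    have h3 : ∑ s : (ZMod p)ˣ, (F (m s) + F (m (r * s))) = (p - 1) * (F (m 1) + F (m r)) := by
      rw [Finset.sum_congr rfl (g := fun _ => F (m 1) + F (m r))
        fun s _ => by rcases hval s with ⟨e1, e2⟩ | ⟨e1, e2⟩ <;> rw [e1, e2]; exact add_comm _ _]
      rw [Finset.sum_const, Finset.card_univ, ZMod.card_units, smul_eq_mul]
    rw [Finset.sum_add_distrib, h2] at h3
    rw [h1, mul_add, ← h3, two_mul (∑ s : (ZMod p)ˣ, F (m s))]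

/-- The character bound in terms of multiplicities. -/
lemma two_mul_mul_sum_eigenMult_sq_le [Fintype G] (h : SpinCover π z) (hR : EvenRep π z R)
    (hz : z ≠ 1) (hp : Odd p) (hg : g ^ p = 1) (hπg : π g = Equiv.addRight 1)
    (hchar : ∑ x : G with Perm.sign (π x) = 1, charSq R x =
      Finset.card {x : G | Perm.sign (π x) = 1}) :
    2 * (p * ∑ s, eigenMult p (R g) s ^ 2) ≤
      2 * (∑ s, eigenMult p (R g) s) ^ 2 + p * (p - 1) := by
  have hge : Perm.sign (π g) = 1 :=
    Perm.sign_eq_one_of_odd_pow hp (by rw [← map_pow, hg, map_one])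
  have hX : R g ^ p = 1 := by rw [← hR.pow hge, hg, hR.one]
  have h1 := two_mul_sum_charSq_le h hR hz hp hg hπg hchar
  have h2 := sum_normSq_trace_pow hX
  rw [Fintype.sum_eq_add_sum_subtype_ne _ (0 : ZMod p)] at h2
  have h3 : ∑ i : {i : ZMod p // i ≠ 0}, Complex.normSq (LinearMap.trace ℂ V (R g ^ i.1.val)) =
      ∑ j : (ZMod p)ˣ, charSq R (g ^ (j : ZMod p).val) := by
    refine Fintype.sum_equiv unitsEquivNeZero.symm _ _ fun x => ?_
    rw [charSq, hR.pow hge]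
    rfl
  rw [h3, ZMod.val_zero, pow_zero, LinearMap.trace_one, ← sum_eigenMult hX,
    Complex.normSq_natCast] at h2
  have h4 : 2 * (p * ∑ s, (eigenMult p (R g) s : ℝ) ^ 2) ≤
      2 * (∑ s, eigenMult p (R g) s : ℕ) ^ 2 + p * (p - 1 : ℕ) := by
    rw [← h2]
    linarith [sq ((∑ s, eigenMult p (R g) s : ℕ) : ℝ)]
  exact_mod_cast h4

end PrimeMult

section Numerics

lemma sq_lt_eight_pow {k : ℕ} (hk : 3 ≤ k) : (4 * k + 3) ^ 2 < 8 ^ k := by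
  induction k, hk using Nat.le_induction with
  | base => norm_num
  | succ k hk ih =>
    rw [pow_succ 8]
    nlinarith

lemma two_mul_lt_eight_pow {k : ℕ} (hk : 2 ≤ k) : 8 * k + 7 < 8 ^ k := by
  induction k, hk using Nat.le_induction with
  | base => norm_num
  | succ k hk ih =>
    rw [pow_succ 8]
    omega

lemma eight_pow_or {h : ℕ} (hh : 5 ≤ h) (hp : (2 * h + 1).Prime) {d : ℕ}
    (hd : 8 ^ ((2 * h + 1) / 8) ∣ d) (hd' : h = 6 → 16 ∣ d) :
    (h = 5 ∧ 8 ∣ d) ∨ (h = 6 ∧ 16 ∣ d) ∨ (h = 8 ∧ 64 ∣ d) ∨ (h = 9 ∧ 64 ∣ d) ∨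
      (h = 11 ∧ 64 ∣ d) ∨ (12 ≤ h ∧ ∃ D, h ^ 2 < D ∧ 2 * h < D ∧ D ∣ d) := by
  by_cases h12 : 12 ≤ h
  · have hk : 3 ≤ (2 * h + 1) / 8 := by omega
    have hk2 : h ≤ 4 * ((2 * h + 1) / 8) + 3 := by omega
    have := sq_lt_eight_pow hk
    have := two_mul_lt_eight_pow (by omega : 2 ≤ (2 * h + 1) / 8)
    exact Or.inr (Or.inr (Or.inr (Or.inr (Or.inr ⟨h12, _, by nlinarith, by omega, hd⟩))))
  · push Not at h12
    interval_cases h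
    · simpa using hd
    · simpa using hd'
    · norm_num at hp
    · simpa using hd
    · simpa using hd
    · norm_num at hp
    · simpa using hd

lemma ne_zero_of_sq_le {h : ℕ} (hh : 5 ≤ h) (hp : (2 * h + 1).Prime) {m a b d : ℕ}
    (hd0 : 0 < d) (hdm : d = m + h * (a + b))
    (hsq : (2 * h + 1) * (m ^ 2 + h * (a ^ 2 + b ^ 2)) ≤ d ^ 2 + (2 * h + 1) * h)
    (hd : 8 ^ ((2 * h + 1) / 8) ∣ d) (hd' : h = 6 → 16 ∣ d) : m ≠ 0 := by
  rintro rfl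
  have hc : (a + b) ^ 2 ≤ 4 * h + 2 := by
    have h1 : h * ((2 * h + 1) * (a ^ 2 + b ^ 2)) ≤ h * (h * (a + b) ^ 2 + (2 * h + 1)) := by
      rw [hdm] at hsq
      nlinarith
    have h2 := le_of_mul_le_mul_left h1 (by omega)
    have h3 : (a + b) ^ 2 ≤ 2 * (a ^ 2 + b ^ 2) := add_sq_le
    nlinarith
  have hc0 : 0 < a + b := by
    rcases Nat.eq_zero_or_pos (a + b) with e | e
    · rw [e] at hdm
      omega
    · exact e
  rw [zero_add] at hdm
  generalize a + b = c at *
  have hor := eight_pow_or hh hp hd hd'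
  rcases hor with ⟨rfl, h1⟩ | ⟨rfl, h1⟩ | ⟨rfl, h1⟩ | ⟨rfl, h1⟩ | ⟨rfl, h1⟩ | ⟨h12, D, hD, -, h1⟩
  · have : c ≤ 4 := by nlinarith
    omega
  · have : c ≤ 5 := by nlinarith
    omega
  · have : c ≤ 5 := by nlinarith
    omega
  · have : c ≤ 6 := by nlinarith
    omega
  · have : c ≤ 6 := by nlinarith
    omega
  · have : c ≤ h := by nlinarith
    have := Nat.le_of_dvd hd0 h1
    nlinarith

lemma ne_zero_of_sq_le_left {h : ℕ} (hh : 5 ≤ h) (hp : (2 * h + 1).Prime) {m a b d : ℕ}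
    (hd0 : 0 < d) (hdm : d = m + h * (a + b))
    (hsq : (2 * h + 1) * (m ^ 2 + h * (a ^ 2 + b ^ 2)) ≤ d ^ 2 + (2 * h + 1) * h)
    (hd : 8 ^ ((2 * h + 1) / 8) ∣ d) (hd' : h = 6 → 16 ∣ d) : b ≠ 0 := by
  rintro rfl
  rw [add_zero] at hdm
  have h1 : 2 * m ^ 2 + (h + 1) * a ^ 2 ≤ 2 * m * a + (2 * h + 1) := by
    have h1 : h * (2 * m ^ 2 + (h + 1) * a ^ 2) ≤ h * (2 * m * a + (2 * h + 1)) := by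
      rw [hdm] at hsq
      nlinarith
    exact le_of_mul_le_mul_left h1 (by omega)
  have ha : a ≤ 1 := by
    by_contra! ha
    have ha2 : 4 ≤ a ^ 2 := by nlinarith
    have ha3 : h * 4 ≤ h * a ^ 2 := Nat.mul_le_mul_left h ha2
    have hm2 : 4 * (m * a) ≤ 4 * m ^ 2 + a ^ 2 := by
      zify
      linarith [sq_nonneg (2 * (m : ℤ) - a)]
    linarith
  have hor := eight_pow_or hh hp hd hd'
  have hm : m ≤ h := by
    interval_cases a
    · nlinarith
    · nlinarith
  have hle : ∀ D, D ∣ d → D ≤ d := fun D => Nat.le_of_dvd hd0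
  have hdl : d ≤ m + h := by
    rw [hdm]
    nlinarith
  rcases hor with ⟨rfl, h2⟩ | ⟨rfl, h2⟩ | ⟨rfl, h2⟩ | ⟨rfl, h2⟩ | ⟨rfl, h2⟩ | ⟨h12, D, hD, hD2, h2⟩
  · have := hle _ h2
    have : m ≤ 2 := by
      interval_cases a
      · nlinarith
      · nlinarith
    omega
  · have := hle _ h2
    omega
  · have := hle _ h2
    omega
  · have := hle _ h2
    omega
  · have := hle _ h2
    omega
  · have := hle _ h2
    omega

end Numerics

section InvolutionSplitting

open Module

variable {V : Type*} [AddCommGroup V] [Module ℂ V]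

/-- Cutting an idempotent by a commuting involution. -/
noncomputable def cutInvolution (P A : End ℂ V) : End ℂ V := (2⁻¹ : ℂ) • (P * (1 + A))

lemma IsIdempotentElem.cutInvolution {P A : End ℂ V} (hP : IsIdempotentElem P) (hA : A * A = 1)
    (hPA : Commute P A) : IsIdempotentElem (cutInvolution P A) := by
  have h1 : (P * (1 + A)) * (P * (1 + A)) = (2 : ℂ) • (P * (1 + A)) := by
    have h2 : Commute P (1 + A) := (Commute.one_right P).add_right hPA
    have h3 : (1 + A) * (1 + A) = (2 : ℂ) • (1 + A) := by
      rw [mul_add, add_mul, add_mul, hA, two_smul]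
      simp only [one_mul, mul_one]
      abel
    rw [mul_assoc, ← mul_assoc (1 + A), ← h2.eq, mul_assoc P, ← mul_assoc P, hP.eq, h3,
      mul_smul_comm]
  rw [IsIdempotentElem, _root_.cutInvolution, smul_mul_smul_comm, h1, smul_smul]
  norm_num

lemma Commute.cutInvolution_left {P A B : End ℂ V} (hP : Commute P B) (hA : Commute A B) :
    Commute (cutInvolution P A) B :=
  (hP.mul_left ((Commute.one_left B).add_left hA)).smul_left _

lemma trace_cutInvolution_mul (P A B : End ℂ V) : LinearMap.trace ℂ V (cutInvolution P A * B) =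
    2⁻¹ * (LinearMap.trace ℂ V (P * B) + LinearMap.trace ℂ V (P * (A * B))) := by
  rw [cutInvolution, smul_mul_assoc, map_smul, smul_eq_mul, mul_add, mul_one, add_mul, map_add,
    mul_assoc]

lemma trace_cutInvolution (P A : End ℂ V) : LinearMap.trace ℂ V (cutInvolution P A) =
    2⁻¹ * (LinearMap.trace ℂ V P + LinearMap.trace ℂ V (P * A)) := by
  have := trace_cutInvolution_mul P A 1
  rwa [mul_one, mul_one, mul_one] at this

end InvolutionSplitting

namespace SpinCover

open Equiv

variable {G α : Type*} [Group G] [DecidableEq α] [Fintype α] {π : G →* Perm α} {z : G}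

lemma commute_of_two_blocks (h : SpinCover π z) {a b c d a' b' c' d' : α}
    (hnd : [a, b, c, d, a', b', c', d'].Nodup) {x y : G}
    (hx : π x = swap a b * swap c d * (swap a' b' * swap c' d'))
    (hy : π y = swap a c * swap b d * (swap a' c' * swap b' d')) : Commute x y := by
  obtain ⟨u, hu⟩ := h.surj (swap a b * swap c d)
  obtain ⟨u', hu'⟩ := h.surj (swap a' b' * swap c' d')
  obtain ⟨v, hv⟩ := h.surj (swap a c * swap b d)
  obtain ⟨v', hv'⟩ := h.surj (swap a' c' * swap b' d')
  have hzc : ∀ w : G, Commute z w := h.central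
  simp only [List.nodup_cons, List.mem_cons, List.not_mem_nil, or_false, not_or, List.nodup_nil,
    and_true, not_false_eq_true] at hnd
  obtain ⟨⟨ab, ac, ad, aa', ab', ac', ad'⟩, ⟨bc, bd, ba', bb', bc', bd'⟩,
    ⟨cd, ca', cb', cc', cd'⟩, ⟨da', db', dc', dd'⟩, ⟨nab, nac, nad⟩, ⟨nbc, nbd⟩, ncd⟩ := hnd
  have sgn : ∀ {p q r s : α} {w : G}, p ≠ q → r ≠ s → π w = swap p q * swap r s →
      Perm.sign (π w) = 1 := by
    intro p q r s w h1 h2 hw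
    rw [hw, Perm.sign_mul, Perm.sign_swap h1, Perm.sign_swap h2]; rfl
  have e1 : v * u = z * (u * v) := by
    refine h.anticommute_of_double_swap (a := a) (b := b) (c := c) (d := d)
      (by simp [*]) (sgn ab cd hu) ?_ ?_ ?_ ?_ hv <;>
    · rw [hu]; simp only [Perm.mul_apply, swap_apply_def]; grind
  have e2 : v' * u' = z * (u' * v') := by
    refine h.anticommute_of_double_swap (a := a') (b := b') (c := c') (d := d')
      (by simp [*]) (sgn nab ncd hu') ?_ ?_ ?_ ?_ hv' <;>
    · rw [hu']; simp only [Perm.mul_apply, swap_apply_def]; grind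
  have e3 : Commute u v' := h.commute_of_even (sgn nac nbd hv') (by
    rw [hu, hv']
    intro p hp
    have : p ∈ ({a, b, c, d} : Set α) := mem_of_double_swap_ne (by simp) (by simp) (by simp)
      (by simp) hp
    simp only [Perm.mul_apply, swap_apply_def]
    grind)
  have e4 : Commute u' v := h.commute_of_even (sgn ac bd hv) (by
    rw [hu', hv]
    intro p hp
    have : p ∈ ({a', b', c', d'} : Set α) := mem_of_double_swap_ne (by simp) (by simp) (by simp)
      (by simp) hp
    simp only [Perm.mul_apply, swap_apply_def]
    grind)
  have key : Commute (u * u') (v * v') := by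
    rw [Commute, SemiconjBy]
    calc u * u' * (v * v') = u * (u' * v) * v' := by group
      _ = u * v * (u' * v') := by rw [e4.eq]; group
      _ = (z * (u * v)) * (z * (u' * v')) := by
        rw [mul_assoc z, h.mul_z, h.z_mul_z]
      _ = v * (u * v') * u' := by rw [← e1, ← e2]; group
      _ = v * v' * (u * u') := by rw [e3.eq]; group
  have hx' := h.eq_or_of_map_eq (x := x) (y := u * u') (by rw [hx, map_mul, hu, hu'])
  have hy' := h.eq_or_of_map_eq (x := y) (y := v * v') (by rw [hy, map_mul, hv, hv'])
  have key2 : ∀ w, Commute (u * u') w → Commute x w := fun w hw => by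
    rcases hx' with rfl | rfl
    · exact hw
    · exact (hzc w).mul_left hw
  apply key2
  rcases hy' with rfl | rfl
  · exact key
  · exact ((hzc _).symm).mul_right key

end SpinCover

namespace EvenRep

open Equiv Module

variable {G α V : Type*} [Group G] [DecidableEq α] [Fintype α] [AddCommGroup V] [Module ℂ V]
  {π : G →* Perm α} {z : G} {R : G → Module.End ℂ V}

lemma exists_smul_mul_self (hR : EvenRep π z R) (h : SpinCover π z) {x : G}
    (hx : Perm.sign (π x) = 1) (hxx : π x * π x = 1) : ∃ c : ℂ, (c • R x) * (c • R x) = 1 := by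
  rw [← map_mul] at hxx
  rcases h.ker _ hxx with h1 | h1
  · exact ⟨1, by rw [one_smul, ← hR.mul _ _ hx hx, h1, hR.one]⟩
  · refine ⟨Complex.I, ?_⟩
    rw [smul_mul_smul_comm, ← hR.mul _ _ hx hx, h1, hR.spin, Complex.I_mul_I, neg_one_smul, neg_neg]

lemma trace_mul_eq_zero (hR : EvenRep π z R) (h : SpinCover π z) {P : End ℂ V} {x y : G}
    (hx : Perm.sign (π x) = 1) (hy : Perm.sign (π y) = 1) (hP : Commute P (R y))
    (hyx : y * x = z * (x * y)) : LinearMap.trace ℂ V (P * R x) = 0 := by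
  have h1 : R y * R x = - (R x * R y) := by
    rw [← hR.mul _ _ hy hx, hyx, hR.map_z_mul h (sign_mul hx hy), hR.mul _ _ hx hy]
  have h2 : R y * R y⁻¹ = 1 := by
    rw [← hR.mul _ _ hy (sign_inv hy), mul_inv_cancel, hR.one]
  have h3 : LinearMap.trace ℂ V (P * R x) = - LinearMap.trace ℂ V (P * R x) := by
    calc LinearMap.trace ℂ V (P * R x) = LinearMap.trace ℂ V (R y⁻¹ * (R y * P * R x)) := by
          rw [mul_assoc, ← mul_assoc (R y⁻¹), hR.inv_mul_self hy, one_mul]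
      _ = LinearMap.trace ℂ V (R y * P * R x * R y⁻¹) := LinearMap.trace_mul_comm _ _ _
      _ = LinearMap.trace ℂ V (P * (R y * R x) * R y⁻¹) := by rw [← hP.eq, mul_assoc P]
      _ = - LinearMap.trace ℂ V (P * R x * (R y * R y⁻¹)) := by
          rw [h1, mul_neg, neg_mul, map_neg]; simp only [mul_assoc]
      _ = _ := by rw [h2, mul_one]
  linear_combination (1/2 : ℂ) * h3

/-- The trace against an involution moving two pairs of points off `S` vanishes. -/
lemma trace_mul_eq_zero_of_double_swap (hR : EvenRep π z R) (h : SpinCover π z) {P : End ℂ V}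
    {S : Set α} (hP : ∀ y, Perm.sign (π y) = 1 → (∀ a ∈ S, π y a = a) → Commute P (R y))
    {a b c d : α} (hnd : [a, b, c, d].Nodup) (ha : a ∉ S) (hb : b ∉ S) (hc : c ∉ S) (hd : d ∉ S)
    {x : G} (hx : Perm.sign (π x) = 1) (hxa : π x a = b) (hxb : π x b = a) (hxc : π x c = d)
    (hxd : π x d = c) : LinearMap.trace ℂ V (P * R x) = 0 := by
  obtain ⟨y, hy⟩ := h.surj (swap a c * swap b d)
  have hnd' := hnd
  simp only [List.nodup_cons, List.mem_cons, List.not_mem_nil, or_false, not_or, List.nodup_nil,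
    and_true, not_false_eq_true] at hnd'
  obtain ⟨⟨h12, h13, h14⟩, ⟨h23, h24⟩, h34⟩ := hnd'
  have hye : Perm.sign (π y) = 1 := by
    rw [hy, Perm.sign_mul, Perm.sign_swap h13, Perm.sign_swap h24]; rfl
  refine hR.trace_mul_eq_zero h hx hye (hP y hye fun s hs => ?_)
    (h.anticommute_of_double_swap hnd hx hxa hxb hxc hxd hy)
  by_contra hne
  rw [hy] at hne
  exact mem_of_double_swap_ne (H := Sᶜ) ha hc hb hd hne hs

/-- There is an idempotent of rank `dim V / m` commuting with all elements fixing `S`. -/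
def HasSplitting (π : G →* Perm α) (R : G → Module.End ℂ V) (S : Set α) (m : ℕ) : Prop :=
  ∃ P : End ℂ V, IsIdempotentElem P ∧ (m : ℂ) * LinearMap.trace ℂ V P = finrank ℂ V ∧
    ∀ y, Perm.sign (π y) = 1 → (∀ a ∈ S, π y a = a) → Commute P (R y)

lemma HasSplitting.four_points (hR : EvenRep π z R) (h : SpinCover π z) {S : Set α} {m : ℕ}
    (hS : HasSplitting π R S m) {a b c d : α} (hnd : [a, b, c, d].Nodup) (ha : a ∉ S)
    (hb : b ∉ S) (hc : c ∉ S) (hd : d ∉ S) :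
    HasSplitting π R (S ∪ {a, b, c, d}) (2 * m) := by
  obtain ⟨P, hP, htr, hcomm⟩ := hS
  obtain ⟨x, hx⟩ := h.surj (swap a b * swap c d)
  have hnd' := hnd
  simp only [List.nodup_cons, List.mem_cons, List.not_mem_nil, or_false, not_or, List.nodup_nil,
    and_true, not_false_eq_true] at hnd'
  obtain ⟨⟨h12, h13, h14⟩, ⟨h23, h24⟩, h34⟩ := hnd'
  have hxe : Perm.sign (π x) = 1 := by
    rw [hx, Perm.sign_mul, Perm.sign_swap h12, Perm.sign_swap h34]; rfl
  have hxx : π x * π x = 1 := by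
    rw [hx]
    ext p
    simp only [Perm.mul_apply, swap_apply_def, Perm.one_apply]
    grind
  obtain ⟨r, hr⟩ := hR.exists_smul_mul_self h hxe hxx
  have ht : LinearMap.trace ℂ V (P * R x) = 0 := by
    refine hR.trace_mul_eq_zero_of_double_swap h hcomm hnd ha hb hc hd hxe ?_ ?_ ?_ ?_ <;>
    · rw [hx]; simp only [Perm.mul_apply, swap_apply_def]; grind
  refine ⟨cutInvolution P (r • R x), hP.cutInvolution hr ?_, ?_, ?_⟩
  · refine (hcomm x hxe fun s hs => ?_).smul_right _
    by_contra hne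
    rw [hx] at hne
    exact mem_of_double_swap_ne (H := Sᶜ) ha hb hc hd hne hs
  · rw [trace_cutInvolution, mul_smul_comm, map_smul, ht, smul_zero, add_zero, ← htr]
    push_cast
    ring
  · intro y hy hyS
    refine (hcomm y hy fun s hs => hyS s (Or.inl hs)).cutInvolution_left ?_
    refine (hR.commute hxe hy (h.commute_of_even hy fun s hs => hyS s (Or.inr ?_))).smul_left _
    rw [hx] at hs
    exact mem_of_double_swap_ne (by simp) (by simp) (by simp) (by simp) hs

variable [FiniteDimensional ℂ V]

lemma hasSplitting_empty : HasSplitting π R ∅ 1 :=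
  ⟨1, IsIdempotentElem.one, by rw [LinearMap.trace_one, Nat.cast_one, one_mul],
    fun _ _ _ => Commute.one_left _⟩

lemma HasSplitting.dvd {S : Set α} {m : ℕ} (hS : HasSplitting π R S m) : m ∣ finrank ℂ V := by
  obtain ⟨P, hP, htr, -⟩ := hS
  rw [(LinearMap.IsIdempotentElem.isProj_range P hP).trace] at htr
  exact ⟨_, by exact_mod_cast htr.symm⟩

end EvenRep

lemma Equiv.Perm.viaEmbeddingHom_swap {ι α : Type*} [DecidableEq ι] [DecidableEq α] (f : ι ↪ α)
    (i j : ι) : Perm.viaEmbeddingHom f (swap i j) = swap (f i) (f j) := by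
  ext x
  rw [viaEmbeddingHom_apply]
  by_cases hx : x ∈ Set.range f
  · obtain ⟨k, rfl⟩ := hx
    rw [viaEmbedding_apply, swap_apply_def, swap_apply_def]
    simp only [f.injective.eq_iff, apply_ite f]
  · rw [viaEmbedding_apply_of_notMem _ _ _ hx, swap_apply_of_ne_of_ne] <;>
    · rintro rfl
      exact hx ⟨_, rfl⟩

namespace EvenRep

open Equiv Module

variable {G α V : Type*} [Group G] [DecidableEq α] [Fintype α] [AddCommGroup V] [Module ℂ V]
  {π : G →* Perm α} {z : G} {R : G → Module.End ℂ V}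

lemma HasSplitting.eight_points (hR : EvenRep π z R) (h : SpinCover π z) {S : Set α} {m : ℕ}
    (hS : HasSplitting π R S m) (f : Fin 8 ↪ α) (hf : ∀ i, f i ∉ S) :
    HasSplitting π R (S ∪ Set.range f) (8 * m) := by
  obtain ⟨P, hP, htr, hcomm⟩ := hS
  have two_blocks : ∀ {a b c d a' b' c' d' : Fin 8} {x y : G},
      [a, b, c, d, a', b', c', d'].Nodup →
      π x = Perm.viaEmbeddingHom f (swap a b * swap c d * (swap a' b' * swap c' d')) →
      π y = Perm.viaEmbeddingHom f (swap a c * swap b d * (swap a' c' * swap b' d')) →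
      Commute x y := by
    intro a b c d a' b' c' d' x y hnd hx hy
    simp only [map_mul, Perm.viaEmbeddingHom_swap] at hx hy
    exact h.commute_of_two_blocks (by simpa using hnd.map f.injective) hx hy
  have sgn : ∀ {σ : Perm (Fin 8)} {x : G}, π x = Perm.viaEmbeddingHom f σ →
      (∃ a b c d a' b' c' d', [a, b, c, d, a', b', c', d'].Nodup ∧
        σ = swap a b * swap c d * (swap a' b' * swap c' d')) → Perm.sign (π x) = 1 := by
    rintro σ x hx ⟨a, b, c, d, a', b', c', d', hnd, rfl⟩
    simp only [List.nodup_cons, List.mem_cons, List.not_mem_nil, or_false, not_or] at hnd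
    simp only [hx, map_mul, Perm.viaEmbeddingHom_swap]
    rw [Perm.sign_swap (f.injective.ne hnd.1.1), Perm.sign_swap (f.injective.ne hnd.2.2.1.1),
      Perm.sign_swap (f.injective.ne hnd.2.2.2.2.1.1),
      Perm.sign_swap (f.injective.ne hnd.2.2.2.2.2.2.1)]
    rfl
  have tr0 : ∀ {σ : Perm (Fin 8)} {x : G} (a b c d : Fin 8), π x = Perm.viaEmbeddingHom f σ →
      Perm.sign (π x) = 1 → [a, b, c, d].Nodup → σ a = b → σ b = a → σ c = d → σ d = c →
      LinearMap.trace ℂ V (P * R x) = 0 := by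
    intro σ x a b c d hx hxe hnd ha hb hc hd
    refine hR.trace_mul_eq_zero_of_double_swap h hcomm (a := f a) (b := f b) (c := f c) (d := f d)
      (by simpa using hnd.map f.injective) (hf _) (hf _) (hf _) (hf _) hxe ?_ ?_ ?_ ?_ <;>
    · rw [hx, Perm.viaEmbeddingHom_apply, Perm.viaEmbedding_apply]
      first | rw [ha] | rw [hb] | rw [hc] | rw [hd]
  have sq : ∀ {σ : Perm (Fin 8)} {x : G}, π x = Perm.viaEmbeddingHom f σ → σ * σ = 1 →
      π x * π x = 1 := by
    intro σ x hx hσ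
    rw [hx, ← map_mul, hσ, map_one]
  have off : ∀ {σ : Perm (Fin 8)} {x : G}, π x = Perm.viaEmbeddingHom f σ →
      ∀ s, π x s ≠ s → s ∈ Set.range f := by
    intro σ x hx s hs
    by_contra hne
    rw [hx, Perm.viaEmbeddingHom_apply, Perm.viaEmbedding_apply_of_notMem _ _ _ hne] at hs
    exact hs rfl
  obtain ⟨x₁, h₁⟩ := h.surj (Perm.viaEmbeddingHom f (swap 0 1 * swap 2 3 * (swap 4 5 * swap 6 7)))
  obtain ⟨x₂, h₂⟩ := h.surj (Perm.viaEmbeddingHom f (swap 0 2 * swap 1 3 * (swap 4 6 * swap 5 7)))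
  obtain ⟨x₃, h₃⟩ := h.surj (Perm.viaEmbeddingHom f (swap 0 4 * swap 1 5 * (swap 2 6 * swap 3 7)))
  have e₁ := sgn h₁ ⟨0, 1, 2, 3, 4, 5, 6, 7, by decide, rfl⟩
  have e₂ := sgn h₂ ⟨0, 2, 1, 3, 4, 6, 5, 7, by decide, rfl⟩
  have e₃ := sgn h₃ ⟨0, 4, 1, 5, 2, 6, 3, 7, by decide, rfl⟩
  have c₁₂ : Commute x₁ x₂ := two_blocks (a := 0) (b := 1) (c := 2) (d := 3) (a' := 4) (b' := 5)
    (c' := 6) (d' := 7) (by decide) h₁ h₂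
  have c₁₃ : Commute x₁ x₃ := two_blocks (a := 0) (b := 1) (c := 4) (d := 5) (a' := 2) (b' := 3)
    (c' := 6) (d' := 7) (by decide) (h₁.trans (congrArg _ (by decide)))
    (h₃.trans (congrArg _ (by decide)))
  have c₂₃ : Commute x₂ x₃ := two_blocks (a := 0) (b := 2) (c := 4) (d := 6) (a' := 1) (b' := 3)
    (c' := 5) (d' := 7) (by decide) (h₂.trans (congrArg _ (by decide)))
    (h₃.trans (congrArg _ (by decide)))
  obtain ⟨r₁, hr₁⟩ := hR.exists_smul_mul_self h e₁ (sq h₁ (by decide))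
  obtain ⟨r₂, hr₂⟩ := hR.exists_smul_mul_self h e₂ (sq h₂ (by decide))
  obtain ⟨r₃, hr₃⟩ := hR.exists_smul_mul_self h e₃ (sq h₃ (by decide))
  have hPc : ∀ {x : G}, Perm.sign (π x) = 1 → (∀ s, π x s ≠ s → s ∈ Set.range f) →
      Commute P (R x) := by
    intro x hx hs
    refine hcomm x hx fun s hsS => ?_
    by_contra hne
    obtain ⟨i, rfl⟩ := hs s hne
    exact hf i hsS
  have d₁₂ : Commute (r₁ • R x₁) (r₂ • R x₂) :=
    ((hR.commute e₁ e₂ c₁₂).smul_left _).smul_right _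
  have d₁₃ : Commute (r₁ • R x₁) (r₃ • R x₃) :=
    ((hR.commute e₁ e₃ c₁₃).smul_left _).smul_right _
  have d₂₃ : Commute (r₂ • R x₂) (r₃ • R x₃) :=
    ((hR.commute e₂ e₃ c₂₃).smul_left _).smul_right _
  have p₁ : Commute P (r₁ • R x₁) := (hPc e₁ (off h₁)).smul_right _
  have p₂ : Commute P (r₂ • R x₂) := (hPc e₂ (off h₂)).smul_right _
  have p₃ : Commute P (r₃ • R x₃) := (hPc e₃ (off h₃)).smul_right _
  refine ⟨cutInvolution (cutInvolution (cutInvolution P (r₁ • R x₁)) (r₂ • R x₂)) (r₃ • R x₃),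
    ((hP.cutInvolution hr₁ p₁).cutInvolution hr₂ (p₂.cutInvolution_left d₁₂)).cutInvolution hr₃
      ((p₃.cutInvolution_left d₁₃).cutInvolution_left d₂₃), ?_, ?_⟩
  · have m₁₂ : π (x₁ * x₂) = _ := (map_mul π x₁ x₂).trans ((congrArg₂ _ h₁ h₂).trans
      (map_mul (Perm.viaEmbeddingHom f) _ _).symm)
    have m₁₃ : π (x₁ * x₃) = _ := (map_mul π x₁ x₃).trans ((congrArg₂ _ h₁ h₃).trans
      (map_mul (Perm.viaEmbeddingHom f) _ _).symm)
    have m₂₃ : π (x₂ * x₃) = _ := (map_mul π x₂ x₃).trans ((congrArg₂ _ h₂ h₃).trans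
      (map_mul (Perm.viaEmbeddingHom f) _ _).symm)
    have m₁₂₃ : π (x₁ * (x₂ * x₃)) = _ := (map_mul π x₁ _).trans ((congrArg₂ _ h₁ m₂₃).trans
      (map_mul (Perm.viaEmbeddingHom f) _ _).symm)
    have t₁ := tr0 0 1 2 3 h₁ e₁ (by decide) (by decide) (by decide) (by decide) (by decide)
    have t₂ := tr0 0 2 1 3 h₂ e₂ (by decide) (by decide) (by decide) (by decide) (by decide)
    have t₃ := tr0 0 4 1 5 h₃ e₃ (by decide) (by decide) (by decide) (by decide) (by decide)
    have t₁₂ := tr0 0 3 1 2 m₁₂ (sign_mul e₁ e₂) (by decide) (by decide) (by decide) (by decide)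
      (by decide)
    have t₁₃ := tr0 0 5 1 4 m₁₃ (sign_mul e₁ e₃) (by decide) (by decide) (by decide) (by decide)
      (by decide)
    have t₂₃ := tr0 0 6 1 7 m₂₃ (sign_mul e₂ e₃) (by decide) (by decide) (by decide) (by decide)
      (by decide)
    have t₁₂₃ := tr0 0 7 1 6 m₁₂₃ (sign_mul e₁ (sign_mul e₂ e₃)) (by decide) (by decide)
      (by decide) (by decide) (by decide)
    rw [hR.mul _ _ e₁ (sign_mul e₂ e₃), hR.mul _ _ e₂ e₃] at t₁₂₃
    rw [hR.mul _ _ e₁ e₂] at t₁₂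
    rw [hR.mul _ _ e₁ e₃] at t₁₃
    rw [hR.mul _ _ e₂ e₃] at t₂₃
    simp only [trace_cutInvolution, trace_cutInvolution_mul, smul_mul_assoc, mul_smul_comm, map_smul, t₁, t₂,
      t₃, t₁₂, t₁₃, t₂₃, t₁₂₃, smul_zero, add_zero, ← htr]
    push_cast
    ring
  · intro y hy hyS
    have hy' : ∀ {σ : Perm (Fin 8)} {x : G} (r : ℂ), π x = Perm.viaEmbeddingHom f σ →
        Perm.sign (π x) = 1 → Commute (r • R x) (R y) := by
      intro σ x r hx hxe
      exact (hR.commute hxe hy (h.commute_of_even hy fun s hs =>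
        hyS s (Or.inr (off hx s hs)))).smul_left _
    exact (((hcomm y hy fun s hs => hyS s (Or.inl hs)).cutInvolution_left
      (hy' r₁ h₁ e₁)).cutInvolution_left (hy' r₂ h₂ e₂)).cutInvolution_left (hy' r₃ h₃ e₃)

variable [FiniteDimensional ℂ V]

lemma hasSplitting_fin {n : ℕ} {π : G →* Perm (Fin n)} (hR : EvenRep π z R) (h : SpinCover π z)
    {k : ℕ} (hk : 8 * k ≤ n) : HasSplitting π R {i : Fin n | i.val < 8 * k} (8 ^ k) := by
  induction k with
  | zero =>
    have : {i : Fin n | i.val < 8 * 0} = ∅ := by ext; simp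
    rw [this]
    exact hasSplitting_empty
  | succ k ih =>
    obtain ⟨f, hf⟩ : ∃ f : Fin 8 ↪ Fin n, ∀ i, (f i).val = 8 * k + i :=
      ⟨⟨fun i => ⟨8 * k + i, by omega⟩, fun i j hij => Fin.ext (by
        have := congrArg Fin.val hij
        exact Nat.add_left_cancel this)⟩, fun i => rfl⟩
    have h1 := (ih (by omega)).eight_points hR h f (fun i => by simp [hf])
    rw [pow_succ']
    convert h1 using 1
    ext i
    simp only [Set.mem_ofPred_eq, Set.mem_union, Set.mem_range]
    constructor
    · intro hi
      by_cases h2 : i.val < 8 * k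
      · exact Or.inl h2
      · exact Or.inr ⟨⟨i.val - 8 * k, by omega⟩, Fin.ext (by simp only [hf]; omega)⟩
    · rintro (h2 | ⟨j, rfl⟩)
      · omega
      · rw [hf]; omega

lemma eight_pow_dvd_finrank {n : ℕ} {π : G →* Perm (Fin n)} (hR : EvenRep π z R)
    (h : SpinCover π z) : 8 ^ (n / 8) ∣ finrank ℂ V :=
  (hasSplitting_fin hR h (by omega)).dvd

lemma sixteen_dvd_finrank {n : ℕ} (hn : 12 ≤ n) {π : G →* Perm (Fin n)} (hR : EvenRep π z R)
    (h : SpinCover π z) : 16 ∣ finrank ℂ V :=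
  ((hasSplitting_fin (k := 1) hR h (by omega)).four_points hR h
    (a := ⟨8, by omega⟩) (b := ⟨9, by omega⟩) (c := ⟨10, by omega⟩) (d := ⟨11, by omega⟩)
    (by simp) (by simp) (by simp) (by simp) (by simp)).dvd

end EvenRep

section Transport

open Equiv

variable {G α β V : Type*} [Group G] [DecidableEq α] [DecidableEq β] {π : G →* Perm α} {z : G}

lemma SpinCover.congr (h : SpinCover π z) (e : α ≃ β) :
    SpinCover ((e.permCongrHom : Perm α →* Perm β).comp π) z where
  surj := e.permCongrHom.surjective.comp h.surj
  central := h.central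
  sq := h.sq
  map_z := (congrArg e.permCongrHom h.map_z).trans (map_one _)
  ker x hx := h.ker x (e.permCongrHom.injective (hx.trans (map_one _).symm))
  anti a b c d hnd x y hx hy := by
    have h1 : ∀ {x : G} {a b : β}, e.permCongrHom (π x) = swap a b →
        π x = swap (e.symm a) (e.symm b) := by
      intro x a b hx
      apply e.permCongrHom.injective
      rw [hx]
      refine Eq.trans ?_ (Equiv.symm_trans_swap_trans (e.symm a) (e.symm b) e).symm
      rw [Equiv.apply_symm_apply, Equiv.apply_symm_apply]
    exact h.anti _ _ _ _ (by simpa using hnd.map e.symm.injective) x y (h1 hx) (h1 hy)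

variable [Fintype α] [Fintype β] [AddCommGroup V] [Module ℂ V] {R : G → Module.End ℂ V}

lemma sign_permCongrHom_comp (π : G →* Perm α) (e : α ≃ β) (x : G) :
    Perm.sign ((e.permCongrHom : Perm α →* Perm β).comp π x) = Perm.sign (π x) :=
  Perm.sign_permCongr e (π x)

lemma EvenRep.congr (hR : EvenRep π z R) (e : α ≃ β) :
    EvenRep ((e.permCongrHom : Perm α →* Perm β).comp π) z R where
  one := hR.one
  mul x y hx hy := hR.mul x y (by rwa [sign_permCongrHom_comp] at hx)
    (by rwa [sign_permCongrHom_comp] at hy)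
  spin := hR.spin

end Transport

section CycleCoordinates

open Equiv

variable {α : Type*} [DecidableEq α] [Fintype α] {σ : Perm α}

/-- Coordinates in which a full cycle of length `l * q` acts by `+ 1` on the first coordinate and
its `l`-th power by `+ 1` on the second. -/
lemma exists_cycle_coordinates {l q : ℕ} [NeZero l] [NeZero q] (hσ : σ.IsCycle)
    (hs : σ.support = Finset.univ) (hlq : Fintype.card α = l * q) :
    ∃ e : ZMod l × ZMod q ≃ α, (∀ x, (e.symm (σ (e x))).1 = x.1 + 1) ∧
      ∀ x, (σ ^ l) (e x) = e (x.1, x.2 + 1) := by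
  have hord : orderOf σ = l * q := by rw [hσ.orderOf, hs, Finset.card_univ, hlq]
  have hq1 : (σ ^ l) ^ q = 1 := by rw [← pow_mul, ← hord, pow_orderOf_eq_one]
  obtain ⟨x₀, hx₀, hcyc⟩ := hσ
  let F : ZMod l × ZMod q → α := fun x => (σ ^ x.1.val) (((σ ^ l) ^ x.2.val) x₀)
  have hF : ∀ k : ℕ, F (k, (k / l : ℕ)) = (σ ^ k) x₀ := by
    intro k
    change (σ ^ (k : ZMod l).val) (((σ ^ l) ^ ((k / l : ℕ) : ZMod q).val) x₀) = _
    rw [pow_val_natCast hq1, ZMod.val_natCast, ← pow_mul, ← Perm.mul_apply, ← pow_add,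
      Nat.mod_add_div]
  have hsurj : Function.Surjective F := by
    intro y
    have hy : σ y ≠ y := Perm.mem_support.mp (hs ▸ Finset.mem_univ y)
    obtain ⟨k, hk⟩ := (hcyc hy).exists_nat_pow_eq
    exact ⟨_, (hF k).trans hk⟩
  have hbij : Function.Bijective F := (Fintype.bijective_iff_surjective_and_card F).mpr
    ⟨hsurj, by rw [Fintype.card_prod, ZMod.card, ZMod.card, hlq]⟩
  have hτ : ∀ x, (σ ^ l) (F x) = F (x.1, x.2 + 1) := by
    intro x
    change (σ ^ l * (σ ^ x.1.val * (σ ^ l) ^ x.2.val)) x₀ =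
      (σ ^ x.1.val * (σ ^ l) ^ (x.2 + 1).val) x₀
    have h1 : ((x.2.val + 1 : ℕ) : ZMod q) = x.2 + 1 := by
      rw [Nat.cast_add, ZMod.natCast_zmod_val, Nat.cast_one]
    rw [← h1, pow_val_natCast hq1, pow_succ', ← mul_assoc, ← mul_assoc, ← pow_add, ← pow_add,
      add_comm]
  refine ⟨Equiv.ofBijective F hbij, fun x => ?_, hτ⟩
  suffices ∃ j, σ (F x) = F (x.1 + 1, j) by
    obtain ⟨j, hj⟩ := this
    rw [Equiv.ofBijective_apply, hj, Equiv.ofBijective_symm_apply_apply]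
  obtain ⟨k, hk⟩ : ∃ k : ℕ, (k : ZMod l) = x.1 ∧ (σ ^ k) x₀ = F x := by
    refine ⟨x.1.val + l * x.2.val, by simp, ?_⟩
    rw [pow_add, pow_mul]; rfl
  refine ⟨((k + 1) / l : ℕ), ?_⟩
  rw [← hk.2, ← Perm.mul_apply, ← pow_succ', ← hF, Nat.cast_add, hk.1, Nat.cast_one]

lemma exists_cycle_coordinate {p : ℕ} [NeZero p] (hσ : σ.IsCycle)
    (hs : σ.support = Finset.univ) (hp : Fintype.card α = p) :
    ∃ e : α ≃ ZMod p, ∀ x, e (σ (e.symm x)) = x + 1 := by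
  obtain ⟨e, he, -⟩ := exists_cycle_coordinates (l := p) (q := 1) hσ hs (by rw [hp, mul_one])
  let : Unique (ZMod 1) := inferInstanceAs (Unique (Fin 1))
  exact ⟨e.symm.trans (Equiv.prodUnique _ _), fun x => he (x, default)⟩

end CycleCoordinates

section Eigenvalues

open Equiv Module ZMod

variable {V : Type*} [AddCommGroup V] [Module ℂ V] [FiniteDimensional ℂ V] [Nontrivial V]
  {G : Type*} [Group G] [Fintype G] {z g : G} {R : G → Module.End ℂ V}

lemma exists_eigenvector_of_prime {p : ℕ} [Fact p.Prime] (hp : 11 ≤ p)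
    {π : G →* Perm (ZMod p)} (h : SpinCover π z) (hR : EvenRep π z R)
    (hg : g ^ p = 1) (hπg : π g = Equiv.addRight 1)
    (hchar : ∑ x : G with Perm.sign (π x) = 1, charSq R x =
      Finset.card {x : G | Perm.sign (π x) = 1})
    (hd : 8 ^ (p / 8) ∣ finrank ℂ V) (hd' : p = 13 → 16 ∣ finrank ℂ V) {μ : ℂ} (hμ : μ ^ p = 1) :
    ∃ u ≠ 0, R g u = μ • u := by
  have hpp : p.Prime := Fact.out
  have hodd : Odd p := hpp.odd_of_ne_two (by omega)
  have hz := hR.z_ne_one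
  have hge : Perm.sign (π g) = 1 :=
    Perm.sign_eq_one_of_odd_pow hodd (by rw [← map_pow, hg, map_one])
  have hX : R g ^ p = 1 := by rw [← hR.pow hge, hg, hR.one]
  obtain ⟨a, b, hab, hF⟩ := exists_eigenMult_values h hR hz hodd hg hπg
  have hsq := two_mul_mul_sum_eigenMult_sq_le h hR hz hodd hg hπg hchar
  have hsum := hF id
  have hsum2 := hF (· ^ 2)
  simp only [id] at hsum hsum2
  rw [sum_eigenMult hX] at hsum hsq
  obtain ⟨k, hk⟩ := hodd
  rw [show p - 1 = 2 * k by omega] at hsum hsum2 hsq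
  set m := eigenMult p (R g) 0
  have hdm : finrank ℂ V = m + k * (a + b) := by linarith
  have hsq' : (2 * k + 1) * (m ^ 2 + k * (a ^ 2 + b ^ 2)) ≤ finrank ℂ V ^ 2 + (2 * k + 1) * k := by
    have : ∑ s, eigenMult p (R g) s ^ 2 = m ^ 2 + k * (a ^ 2 + b ^ 2) := by linarith
    rw [this, hk] at hsq
    linarith
  have h5 : 5 ≤ k := by omega
  have hpos : 0 < finrank ℂ V := finrank_pos
  rw [hk] at hd hpp
  have hm := ne_zero_of_sq_le h5 hpp hpos hdm hsq' hd fun hk6 => hd' (by omega)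
  have hb := ne_zero_of_sq_le_left h5 hpp hpos hdm hsq' hd fun hk6 => hd' (by omega)
  have ha := ne_zero_of_sq_le_left h5 hpp hpos (a := b) (b := a) (by rw [hdm, add_comm a])
    (by rwa [add_comm (b ^ 2)]) hd fun hk6 => hd' (by omega)
  obtain ⟨s, rfl⟩ := exists_stdAddChar_eq hμ
  refine exists_eigenvector_of_eigenMult_ne_zero hX ?_
  by_cases hs : s = 0
  · rwa [hs]
  · rcases hab s hs with h1 | h1 <;> rw [h1] <;> assumption

lemma exists_eigenvector_of_cycle {n : ℕ} (hn : 11 ≤ n) (hodd : Odd n)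
    {π : G →* Perm (Fin n)} (h : SpinCover π z) (hR : EvenRep π z R)
    (hcyc : (π g).IsCycle) (hsupp : (π g).support = Finset.univ) (hg : g ^ n = 1)
    (hchar : ∑ x : G with Perm.sign (π x) = 1, charSq R x =
      Finset.card {x : G | Perm.sign (π x) = 1}) {μ : ℂ} (hμ : μ ^ n = 1) :
    ∃ u ≠ 0, R g u = μ • u := by
  have blocks : ∀ {l q : ℕ}, q.Prime → n = l * q → ((5 ≤ q ∧ 3 ≤ l) ∨ (q = 3 ∧ 7 ≤ l)) →
      ∃ u ≠ 0, R g u = μ • u := by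
    intro l q hq hlq hc
    have : Fact q.Prime := ⟨hq⟩
    have : NeZero l := ⟨by omega⟩
    obtain ⟨e, he, he'⟩ := exists_cycle_coordinates hcyc hsupp (by rw [Fintype.card_fin, hlq])
    rw [hlq] at hg hμ hodd
    rw [Nat.odd_mul] at hodd
    refine exists_eigenvector_of_blocks (h.congr e.symm) (hR.congr e.symm) hodd.2 hodd.1 hc hg
      he ?_ hμ
    rw [← map_pow]
    ext1 x
    change e.symm (π (g ^ l) (e x)) = _
    rw [map_pow, he', Equiv.symm_apply_apply]
    rfl
  by_cases hp : n.Prime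
  · have : Fact n.Prime := ⟨hp⟩
    obtain ⟨e, he⟩ := exists_cycle_coordinate hcyc hsupp (Fintype.card_fin n)
    refine exists_eigenvector_of_prime hn (h.congr e) (hR.congr e) hg (Equiv.ext he) ?_
      (hR.eight_pow_dvd_finrank h) ?_ hμ
    · simpa only [sign_permCongrHom_comp] using hchar
    · exact fun h13 => hR.sixteen_dvd_finrank (by omega) h
  · by_cases h5 : ∃ q, q.Prime ∧ 5 ≤ q ∧ q ∣ n
    · obtain ⟨q, hq, hq5, l, hl⟩ := h5
      refine blocks hq (hl.trans (mul_comm q l)) (Or.inl ⟨hq5, ?_⟩)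
      have h0 : l ≠ 0 := by rintro rfl; omega
      have h1 : l ≠ 1 := by rintro rfl; exact hp (by rwa [hl, mul_one])
      have h2 : l ≠ 2 := by rintro rfl; exact (Nat.not_even_iff_odd.mpr hodd) ⟨q, by omega⟩
      omega
    · have h3 : n.minFac = 3 := by
        by_contra h3
        refine h5 ⟨n.minFac, Nat.minFac_prime (by omega), ?_, n.minFac_dvd⟩
        have h2 := (Nat.minFac_prime (n := n) (by omega)).two_le
        have h4 : n.minFac ≠ 2 := fun e => (Nat.not_even_iff_odd.mpr hodd)
          (even_iff_two_dvd.mpr (e ▸ n.minFac_dvd))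
        have h6 : n.minFac ≠ 4 := fun e => by
          have := Nat.minFac_prime (n := n) (by omega)
          rw [e] at this
          exact absurd this (by decide)
        omega
      obtain ⟨l, hl⟩ : 3 ∣ n := h3 ▸ n.minFac_dvd
      refine blocks Nat.prime_three (hl.trans (mul_comm 3 l)) (Or.inr ⟨rfl, ?_⟩)
      by_contra hlt
      have h5' : l = 5 := by
        obtain ⟨k, hk⟩ := hodd
        omega
      exact h5 ⟨5, Nat.prime_five, le_rfl, 3, by omega⟩

end Eigenvalues

section FinalAssembly

open Module Polynomial

variable {V : Type*} [AddCommGroup V] [Module ℂ V] [FiniteDimensional ℂ V]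

lemma minpoly_eq_of_all_eigenvalues {n : ℕ} (hn : 0 < n) {ε : ℂ} (hε : ε ≠ 0) {X : End ℂ V}
    (hX : X ^ n = ε • 1) (hev : ∀ μ : ℂ, μ ^ n = ε → ∃ u ≠ 0, X u = μ • u) :
    minpoly ℂ X = Polynomial.X ^ n - C ε ∧ (spectrum ℂ X).ncard = n := by
  classical
  have hprim := Complex.isPrimitiveRoot_exp n hn.ne'
  obtain ⟨r, hr⟩ := IsAlgClosed.exists_pow_nat_eq ε hn
  have hcard : (nthRoots n ε).toFinset.card = n := by
    rw [Multiset.toFinset_card_of_nodup (hprim.nthRoots_nodup hε), hprim.card_nthRoots,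
      if_pos ⟨r, hr⟩]
  have hmem : ∀ μ, μ ∈ (nthRoots n ε).toFinset ↔ End.HasEigenvalue X μ := by
    intro μ
    rw [Multiset.mem_toFinset, mem_nthRoots hn]
    constructor
    · intro hμ
      obtain ⟨u, hu, hXu⟩ := hev μ hμ
      exact End.hasEigenvalue_of_hasEigenvector ⟨End.mem_eigenspace_iff.mpr hXu, hu⟩
    · intro h
      obtain ⟨u, hu⟩ := h.exists_hasEigenvector
      have h1 := hu.pow_apply n
      rw [hX, LinearMap.smul_apply, End.one_apply] at h1
      exact (smul_left_injective ℂ hu.2 h1).symm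
  refine ⟨?_, ?_⟩
  · have hmon := minpoly.monic (Algebra.IsIntegral.isIntegral (R := ℂ) X)
    have hdvd : minpoly ℂ X ∣ Polynomial.X ^ n - C ε := minpoly.dvd _ _ (by
      rw [map_sub, map_pow, aeval_X, aeval_C, hX, Algebra.algebraMap_eq_smul_one, sub_self])
    refine (eq_of_monic_of_dvd_of_natDegree_le hmon (monic_X_pow_sub_C ε hn.ne') hdvd ?_).symm
    rw [natDegree_X_pow_sub_C]
    calc n = (nthRoots n ε).toFinset.card := hcard.symm
      _ ≤ (minpoly ℂ X).roots.toFinset.card := Finset.card_le_card fun μ hμ => by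
        rw [Multiset.mem_toFinset, mem_roots hmon.ne_zero]
        exact End.isRoot_of_hasEigenvalue ((hmem μ).mp hμ)
      _ ≤ Multiset.card (minpoly ℂ X).roots := Multiset.toFinset_card_le _
      _ ≤ _ := card_roots' _
  · have : spectrum ℂ X = ↑(nthRoots n ε).toFinset := by
      ext μ
      rw [← End.hasEigenvalue_iff_mem_spectrum, ← hmem, Finset.mem_coe]
    rw [this, Set.ncard_coe_finset, hcard]

lemma trace_eq_conj_of_mul_eq_one {N : ℕ} [NeZero N] {X Y : End ℂ V} (hX : X ^ N = 1)
    (hYX : Y * X = 1) :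
    LinearMap.trace ℂ V Y = starRingEnd ℂ (LinearMap.trace ℂ V X) := by
  have h1 := pow_val_natCast hX 1
  rw [Nat.cast_one, pow_one] at h1
  have h2 : Y = X ^ (-1 : ZMod N).val := by
    have h3 := pow_val_add hX 1 (-1)
    rw [add_neg_cancel, ZMod.val_zero, pow_zero, h1] at h3
    rw [← mul_one Y, h3, ← mul_assoc, hYX, one_mul]
  have h4 := trace_pow_eq_sum hX 1
  rw [h1] at h4
  rw [h2, h4, trace_pow_eq_sum hX, map_sum]
  refine Finset.sum_congr rfl fun s _ => ?_
  rw [map_mul (starRingEnd ℂ), Complex.conj_natCast, ← AddChar.map_neg_eq_conj, mul_one, mul_neg_one]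

lemma sum_normSq_character {H : Type*} [Group H] [Fintype H] [Nontrivial V]
    (ρ : H →* End ℂ V)
    (hirr : ∀ U : Submodule ℂ V, (∀ x, U.map (ρ x) ≤ U) → U = ⊥ ∨ U = ⊤) :
    ∑ x, Complex.normSq (LinearMap.trace ℂ V (ρ x)) = Fintype.card H := by
  have : IsSimpleOrder (Subrepresentation (ρ : Representation ℂ H V)) :=
    { exists_pair_ne := ⟨⊥, ⊤, fun h => bot_ne_top (α := Submodule ℂ V)
        (congrArg Subrepresentation.toSubmodule h)⟩
      eq_bot_or_eq_top := fun U => by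
        have := hirr U.toSubmodule (fun x => Submodule.map_le_iff_le_comap.mpr
          fun v hv => U.apply_mem_toSubmodule x hv)
        exact this.imp (fun h => Subrepresentation.toSubmodule_injective h)
          (fun h => Subrepresentation.toSubmodule_injective h) }
  have hirr' : Representation.IsIrreducible (ρ : Representation ℂ H V) := this
  have hne : (Nat.card H : ℂ) ≠ 0 := Nat.cast_ne_zero.mpr Nat.card_pos.ne'
  let : Invertible (Nat.card H : ℂ) := invertibleOfNonzero hne
  have h1 := Representation.char_orthonormal (ρ : Representation ℂ H V) ρ
  rw [if_pos ⟨Representation.Equiv.refl _⟩, inv_mul_eq_iff_eq_mul₀ hne] at h1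
  apply Complex.ofReal_injective
  rw [Nat.card_eq_fintype_card] at h1
  push_cast at h1 ⊢
  rw [mul_one] at h1
  rw [← h1]
  refine Finset.sum_congr rfl fun x _ => ?_
  have : NeZero (orderOf x) := ⟨(orderOf_pos x).ne'⟩
  rw [← Complex.mul_conj]
  congr 1
  refine (trace_eq_conj_of_mul_eq_one (N := orderOf x) ?_ ?_).symm
  · rw [← map_pow, pow_orderOf_eq_one, map_one]
  · rw [← map_mul, inv_mul_cancel, map_one]

end FinalAssembly

lemma SpinCover.finite {G α : Type*} [Group G] [DecidableEq α] [Finite α]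
    {π : G →* Equiv.Perm α} {z : G} (h : SpinCover π z) : Finite G := by
  choose f hf using h.surj
  refine Finite.of_surjective (fun p : Equiv.Perm α × Bool => if p.2 then z * f p.1 else f p.1)
    fun x => ?_
  rcases h.eq_or_of_map_eq (hf (π x)).symm with h1 | h1
  · exact ⟨(π x, false), h1.symm⟩
  · exact ⟨(π x, true), h1.symm⟩

open Schur Polynomial in
/-- Theorem: for odd `n ≥ 11` and `g ∈ Ã_n = π⁻¹(A_n)` projecting to an `n`-cycle, the
minimal polynomial of `ρ(g)` in every irreducible spin representation `(ρ, V)` of `Ã_n`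
is `X^n − ε_g`; in particular `ρ(g)` has exactly `n` distinct eigenvalues. -/
theorem schur_alternating_minpoly_of_n_cycle (n : ℕ) (hn : 11 ≤ n) (hodd : Odd n)
    (π : Cover n →* Equiv.Perm (Fin n))
    (hπt : ∀ i : Fin (n - 1), π (t n i) = adj n i)
    (hπz : π (z n) = 1)
    (g : (alternatingGroup (Fin n)).comap π)
    (hcyc : (π (g : Cover n)).IsCycle)
    (hsupp : (π (g : Cover n)).support = Finset.univ)
    (V : Type) [AddCommGroup V] [Module ℂ V] [FiniteDimensional ℂ V] [Nontrivial V]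
    (ρ : ((alternatingGroup (Fin n)).comap π) →* Module.End ℂ V)
    (hirr : ∀ U : Submodule ℂ V,
      (∀ h : (alternatingGroup (Fin n)).comap π, U.map (ρ h) ≤ U) → U = ⊥ ∨ U = ⊤)
    (hspin : ∀ x : (alternatingGroup (Fin n)).comap π, (x : Cover n) = z n → ρ x = -1)
    (ε : ℂ)
    (hε : ((g : Cover n) ^ n = 1 ∧ ε = 1) ∨ ((g : Cover n) ^ n = z n ∧ ε = -1)) :
    minpoly ℂ (ρ g) = X ^ n - C ε ∧ (spectrum ℂ (ρ g)).ncard = n := by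
  classical
  have h := spinCover (by omega) π hπt hπz
  have : Finite (Cover n) := h.finite
  let : Fintype (Cover n) := Fintype.ofFinite _
  have hmem : ∀ x : Cover n,
      x ∈ (alternatingGroup (Fin n)).comap π ↔ Equiv.Perm.sign (π x) = 1 := fun x => by
    rw [Subgroup.mem_comap, Equiv.Perm.mem_alternatingGroup]
  let R : Cover n → Module.End ℂ V := fun x =>
    if hx : x ∈ (alternatingGroup (Fin n)).comap π then ρ ⟨x, hx⟩ else 1
  have hRρ : ∀ x : (alternatingGroup (Fin n)).comap π, R x = ρ x := fun x => dif_pos x.2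
  have hze : z n ∈ (alternatingGroup (Fin n)).comap π := (hmem _).mpr (by rw [hπz, map_one])
  have hR : EvenRep π (z n) R :=
    { one := (hRρ 1).trans (map_one ρ)
      mul := fun x y hx hy => by
        have := hRρ (⟨x, (hmem x).mpr hx⟩ * ⟨y, (hmem y).mpr hy⟩)
        rw [map_mul, ← hRρ, ← hRρ] at this
        exact this
      spin := (hRρ ⟨z n, hze⟩).trans (hspin _ rfl) }
  have hchar : ∑ x : Cover n with Equiv.Perm.sign (π x) = 1, charSq R x =
      Finset.card {x : Cover n | Equiv.Perm.sign (π x) = 1} := by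
    rw [Finset.sum_subtype (F := inferInstance) _ (p := (· ∈ (alternatingGroup (Fin n)).comap π))
      (fun x => by rw [hmem]; simp), ← Fintype.card_subtype]
    have h1 := sum_normSq_character ρ hirr
    rw [Fintype.card_congr (Equiv.subtypeEquivRight fun x => (hmem x).symm), ← h1]
    exact Finset.sum_congr rfl fun x _ => by rw [charSq, hRρ]
  have hge : Equiv.Perm.sign (π g) = 1 := (hmem _).mp g.2
  have key : ∀ g' : Cover n, π g' = π g → g' ^ n = 1 → ∀ μ : ℂ, μ ^ n = 1 →
      ∃ u ≠ 0, R g' u = μ • u := fun g' hg' hgn μ hμ =>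
    exists_eigenvector_of_cycle hn hodd h hR (hg' ▸ hcyc) (hg' ▸ hsupp) hgn hchar hμ
  rcases hε with ⟨hgn, rfl⟩ | ⟨hgn, rfl⟩
  · refine minpoly_eq_of_all_eigenvalues (by omega) one_ne_zero ?_ fun μ hμ => ?_
    · rw [← hRρ, ← hR.pow hge, hgn, hR.one, one_smul]
    · rw [← hRρ]
      exact key g rfl hgn μ hμ
  · refine minpoly_eq_of_all_eigenvalues (by omega) (neg_ne_zero.mpr one_ne_zero) ?_ fun μ hμ => ?_
    · rw [← hRρ, ← hR.pow hge, hgn, hR.spin, neg_one_smul]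
    · have hzn : z n ^ n = z n := by
        have hpow (m : ℕ) (hm : Odd m) : z n ^ m = z n := by
          obtain ⟨k, rfl⟩ := hm
          rw [pow_succ, pow_mul, pow_two, h.sq, one_pow, one_mul]
        exact hpow n hodd
      obtain ⟨u, hu, hgu⟩ := key (z n * g) (by rw [map_mul, hπz, one_mul])
        (by rw [(show Commute (z n) g from h.central g).mul_pow, hgn, hzn, h.sq]) (-μ)
        (by rw [hodd.neg_pow, hμ, neg_neg])
      refine ⟨u, hu, ?_⟩
      rw [hR.map_z_mul h hge, LinearMap.neg_apply, neg_smul, neg_inj, hRρ] at hgu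
      exact hgu
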